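/- arXiv:0902.4508 — 2 statements merged into one kernel-verified Lean document; each statement's English description precedes it below -/
import Mathlib

section
/- Suppose d' = d and d/t is even, where t is a positive divisor of d. Then, as (α,β) ranges over F_{p^m} × F_q, the codeword weight w(α,β) equals: (p^t−1)(p^{n−t}−p^{m+d/2−t}) for exactly p^{m−d}(p^n−1)/2 pairs; (p^t−1)(p^{n−t}−p^{m−t}) for exactly p^d(p^m−1)(p^m+1)^2/(2(p^d+1)) pairs; (p^t−1)(p^{n−t}+p^{m−t}) for exactly p^d(p^m−1)(p^n−2p^{n−d}+1)/(2(p^d−1)) pairs; (p^t−1)(p^{n−t}+p^{m+d/2−t}) for exactly p^{m−d}(p^n−1)/2 pairs; (p^t−1)(p^{n−t}+p^{m+d−t}) for exactly (p^{m−d}−1)(p^n−1)/(p^{2d}−1) pairs; and 0 for exactly 1 pair (namely (0,0)); w takes no other values. -/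
open scoped BigOperators Classical

noncomputable section

/-- The map `φ_{α,β}(x) = α x^{p^m} + β x^{p^k} + β^{p^{n-k}} x^{p^{n-k}}`. -/
def phiMap (p m n k : ℕ) {F : Type} [Field F] (α β x : F) : F :=
  α * x ^ p ^ m + β * x ^ p ^ k + β ^ p ^ (n - k) * x ^ p ^ (n - k)

/-- The trace-type sum `x ↦ ∑_{i<r} x^{p^{t i}}`; for `x` in the subfield of size
`p^{t·r}` this is the relative trace down to the subfield of size `p^t`. -/
def trSum (p t r : ℕ) {F : Type} [Field F] (x : F) : F :=
  ∑ i ∈ Finset.range r, x ^ p ^ (t * i)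

/-- `ζ_p^c = exp(2πi·c̃/p)` for a lift `c̃` of `c : F_p`. -/
noncomputable def expChar (p : ℕ) (c : ZMod p) : ℂ :=
  Complex.exp (2 * Real.pi * Complex.I * (c.val : ℂ) / (p : ℂ))

/-- Identify an element of the prime field of `F` with an element of `ZMod p`
(the partial inverse of the algebra map). -/
noncomputable def fToZMod (p : ℕ) {F : Type} [Field F] [Algebra (ZMod p) F] (x : F) : ZMod p :=
  letI : Nonempty (ZMod p) := ⟨0⟩
  Function.invFun (algebraMap (ZMod p) F) x

/-- `T(α,β) = ∑_{x ∈ F_q} ζ_p^{Tr^m_1(α x^{p^m+1}) + Tr^n_1(β x^{p^k+1})}`. -/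
noncomputable def Tsum (p m n k : ℕ) (F : Type) [Field F] [Fintype F] [Algebra (ZMod p) F]
    (α β : F) : ℂ :=
  ∑ x : F, expChar p (fToZMod p (trSum p 1 m (α * x ^ (p ^ m + 1))) +
      fToZMod p (trSum p 1 n (β * x ^ (p ^ k + 1))))

/-- `S(α,β,γ) = ∑_{x ∈ F_q} ζ_p^{Tr^m_1(α x^{p^m+1}) + Tr^n_1(β x^{p^k+1} + γ x)}`. -/
noncomputable def Ssum (p m n k : ℕ) (F : Type) [Field F] [Fintype F] [Algebra (ZMod p) F]
    (α β γ : F) : ℂ :=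
  ∑ x : F, expChar p (fToZMod p (trSum p 1 m (α * x ^ (p ^ m + 1))) +
      fToZMod p (trSum p 1 n (β * x ^ (p ^ k + 1) + γ * x)))

/-- `√(q₀*)` where `q₀* = (−1)^{(q₀−1)/2} q₀`. -/
noncomputable def sqrtStar (q0 : ℕ) : ℂ :=
  if q0 % 4 = 1 then (Real.sqrt q0 : ℂ) else Complex.I * (Real.sqrt q0 : ℂ)

/-- `ζ_p = exp(2πi/p)`. -/
noncomputable def zetaC (p : ℕ) : ℂ := Complex.exp (2 * Real.pi * Complex.I / (p : ℂ))

/-- Number of pairs `(α,β) ∈ F_{p^m} × F_q` with `T(α,β) = v`. -/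
noncomputable def Tcount (p m n k : ℕ) (F : Type) [Field F] [Fintype F] [Algebra (ZMod p) F]
    (v : ℂ) : ℕ :=
  Nat.card {ab : F × F // ab.1 ^ p ^ m = ab.1 ∧ Tsum p m n k F ab.1 ab.2 = v}

/-- Number of triples `(α,β,γ) ∈ F_{p^m} × F_q × F_q` with `S(α,β,γ) = v`. -/
noncomputable def Scount (p m n k : ℕ) (F : Type) [Field F] [Fintype F] [Algebra (ZMod p) F]
    (v : ℂ) : ℕ :=
  Nat.card {abc : F × F × F // abc.1 ^ p ^ m = abc.1 ∧ Ssum p m n k F abc.1 abc.2.1 abc.2.2 = v}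

/-- Hamming weight of the codeword of `C₁` attached to `(α,β)`:
the number of `0 ≤ i ≤ q-2` with `Tr^m_t(α π^{i(p^m+1)}) + Tr^n_t(β π^{i(p^k+1)}) ≠ 0`. -/
noncomputable def wt1 (p m n k t : ℕ) {F : Type} [Field F] (π α β : F) : ℕ :=
  Nat.card {i : ℕ // i ≤ p ^ n - 2 ∧
    trSum p t (m / t) (α * π ^ (i * (p ^ m + 1))) +
    trSum p t (n / t) (β * π ^ (i * (p ^ k + 1))) ≠ 0}

/-- Number of pairs `(α,β) ∈ F_{p^m} × F_q` whose `C₁`-codeword has weight `v`. -/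
noncomputable def wt1count (p m n k t : ℕ) (F : Type) [Field F] [Fintype F] (π : F) (v : ℕ) : ℕ :=
  Nat.card {ab : F × F // ab.1 ^ p ^ m = ab.1 ∧ wt1 p m n k t π ab.1 ab.2 = v}

/-- Hamming weight of the codeword of `C₂` attached to `(α,β,γ)`. -/
noncomputable def wt2 (p m n k t : ℕ) {F : Type} [Field F] (π α β γ : F) : ℕ :=
  Nat.card {i : ℕ // i ≤ p ^ n - 2 ∧
    trSum p t (m / t) (α * π ^ (i * (p ^ m + 1))) +
    trSum p t (n / t) (β * π ^ (i * (p ^ k + 1)) + γ * π ^ i) ≠ 0}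

/-- Number of triples `(α,β,γ)` whose `C₂`-codeword has weight `v`. -/
noncomputable def wt2count (p m n k t : ℕ) (F : Type) [Field F] [Fintype F] (π : F) (v : ℕ) : ℕ :=
  Nat.card {abc : F × F × F // abc.1 ^ p ^ m = abc.1 ∧ wt2 p m n k t π abc.1 abc.2.1 abc.2.2 = v}

namespace CyclicWeight

section Frobenius

variable {p : ℕ} [Fact p.Prime] {F : Type} [Field F] [CharP F p]

/-- The `p^j`-th power map on `F`, as a ring homomorphism. -/
def frob (p : ℕ) [Fact p.Prime] {F : Type} [Field F] [CharP F p] (j : ℕ) : F →+* F :=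
  iterateFrobenius F p j

theorem frob_apply (j : ℕ) (x : F) : frob p j x = x ^ p ^ j := iterateFrobenius_def ..

theorem frob_frob (i j : ℕ) (x : F) : frob p i (frob p j x) = frob p (i + j) x := by
  simp only [frob_apply, ← pow_mul, ← pow_add, add_comm]

theorem frob_zero (x : F) : frob p 0 x = x := by simp [frob_apply]

theorem frob_gcd {i j : ℕ} {x : F} (hi : frob p i x = x) (hj : frob p j x = x) :
    frob p (i.gcd j) x = x := by
  simp only [frob_apply, ← iterate_frobenius p] at *
  exact Function.IsPeriodicPt.gcd hi hj

theorem frob_of_dvd {i j : ℕ} (h : i ∣ j) {x : F} (hi : frob p i x = x) : frob p j x = x := by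
  simp only [frob_apply, ← iterate_frobenius p] at *
  exact Function.IsPeriodicPt.trans_dvd hi h

theorem trSum_eq (t r : ℕ) (x : F) : trSum p t r x = ∑ i ∈ Finset.range r, frob p (t * i) x := by
  simp [trSum, frob_apply]

theorem trSum_add (t r : ℕ) (x y : F) :
    trSum p t r (x + y) = trSum p t r x + trSum p t r y := by
  simp [trSum_eq, Finset.sum_add_distrib]

theorem trSum_mul {t : ℕ} (r : ℕ) {c : F} (hc : frob p t c = c) (x : F) :
    trSum p t r (c * x) = c * trSum p t r x := by
  simp only [trSum_eq, map_mul, Finset.mul_sum]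
  refine Finset.sum_congr rfl fun i _ ↦ ?_
  rw [frob_of_dvd (dvd_mul_right t i) hc]

theorem frob_trSum_sub (t r : ℕ) (x : F) :
    frob p t (trSum p t r x) - trSum p t r x = frob p (t * r) x - x := by
  simp only [trSum_eq, map_sum, frob_frob]
  rw [← Finset.sum_sub_distrib]
  have := Finset.sum_range_sub (fun i ↦ frob p (t * i) x) r
  simp only [mul_add, mul_one, mul_zero, frob_zero, add_comm] at this ⊢
  exact this

theorem trSum_trSum (s t r : ℕ) (x : F) :
    trSum p s t (trSum p (s * t) r x) = trSum p s (t * r) x := by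
  simp only [trSum_eq, map_sum, frob_frob]
  rw [Finset.sum_comm]
  induction r with
  | zero => simp
  | succ r ih =>
    rw [Finset.sum_range_succ, ih, mul_add_one, Finset.sum_range_add]
    congr 1
    refine Finset.sum_congr rfl fun i _ ↦ ?_
    congr 2
    ring

omit [CharP F p] in
theorem card_trSum_eq_zero_le [Fintype F] {t r : ℕ} (ht : 0 < t) (hr : 0 < r) :
    (Finset.univ.filter fun x : F ↦ trSum p t r x = 0).card ≤ p ^ (t * (r - 1)) := by
  have hp := (Fact.out : p.Prime).one_lt
  obtain ⟨r, rfl⟩ : ∃ s, r = s + 1 := ⟨r - 1, by omega⟩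
  let P : Polynomial F := ∑ i ∈ Finset.range (r + 1), Polynomial.X ^ p ^ (t * i)
  have hlt : ∀ s, (∑ i ∈ Finset.range s, (Polynomial.X : Polynomial F) ^ p ^ (t * i)).degree
      < (p ^ (t * s) : ℕ) := by
    intro s
    refine (Polynomial.degree_sum_le _ _).trans_lt ?_
    rw [Finset.sup_lt_iff (WithBot.bot_lt_coe _)]
    intro i hi
    rw [Polynomial.degree_X_pow]
    exact_mod_cast Nat.pow_lt_pow_right hp
      (Nat.mul_lt_mul_of_pos_left (Finset.mem_range.1 hi) ht)
  have hdeg : P.degree = (p ^ (t * r) : ℕ) := by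
    simp only [P, Finset.sum_range_succ]
    rw [Polynomial.degree_add_eq_right_of_degree_lt, Polynomial.degree_X_pow]
    rw [Polynomial.degree_X_pow]; exact hlt r
  have hP : P ≠ 0 := by
    intro h; rw [h, Polynomial.degree_zero] at hdeg; exact WithBot.bot_ne_coe hdeg
  rw [Nat.add_sub_cancel, ← Polynomial.natDegree_eq_of_degree_eq_some hdeg]
  refine Polynomial.card_le_degree_of_subset_roots fun x hx ↦ ?_
  rw [Finset.mem_val, Finset.mem_filter] at hx
  rw [Polynomial.mem_roots hP, Polynomial.IsRoot]
  simpa [P, Polynomial.eval_finsetSum, trSum] using hx.2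

end Frobenius

section Character

variable {p n : ℕ} [Fact p.Prime] {F : Type} [Field F] [Fintype F] [CharP F p]

/-- The elements of `F` fixed by the `p^j`-th power map. -/
def fixedSet (p : ℕ) [Fact p.Prime] (F : Type) [Field F] [Fintype F] [CharP F p] (j : ℕ) :
    Finset F :=
  Finset.univ.filter fun x ↦ frob p j x = x

theorem mem_fixedSet {j : ℕ} {x : F} : x ∈ fixedSet p F j ↔ frob p j x = x := by
  simp [fixedSet]

theorem frob_card (hF : Fintype.card F = p ^ n) (x : F) : frob p n x = x := by
  rw [frob_apply, ← hF, FiniteField.pow_card]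

omit [Fact p.Prime] [CharP F p] in
theorem card_pos_exponent (hF : Fintype.card F = p ^ n) : 0 < n := by
  rcases Nat.eq_zero_or_pos n with rfl | h
  · have := Fintype.one_lt_card (α := F); simp [hF] at this
  · exact h

theorem trSum_mem_fixedSet (hF : Fintype.card F = p ^ n) {t : ℕ} (htn : t ∣ n) (x : F) :
    trSum p t (n / t) x ∈ fixedSet p F t := by
  rw [mem_fixedSet, ← sub_eq_zero, frob_trSum_sub, Nat.mul_div_cancel' htn, frob_card hF, sub_self]

theorem card_fixedSet (hF : Fintype.card F = p ^ n) {t : ℕ} (ht : 0 < t) (htn : t ∣ n) :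
    (fixedSet p F t).card = p ^ t := by
  have hp := (Fact.out : p.Prime).one_lt
  have hn := card_pos_exponent hF
  have hq : 0 < n / t := Nat.div_pos (Nat.le_of_dvd hn htn) ht
  apply le_antisymm
  · rw [← FiniteField.X_pow_card_pow_sub_X_natDegree_eq F ht.ne' hp]
    refine Polynomial.card_le_degree_of_subset_roots fun x hx ↦ ?_
    rw [Finset.mem_val, mem_fixedSet, frob_apply] at hx
    rw [Polynomial.mem_roots (FiniteField.X_pow_card_pow_sub_X_ne_zero F ht.ne' hp)]
    simp [hx]
  · have key := Finset.card_le_mul_card_image (f := trSum p t (n / t)) (Finset.univ : Finset F)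
      (p ^ (t * (n / t - 1))) (by
        intro b hb
        obtain ⟨y, -, rfl⟩ := Finset.mem_image.1 hb
        refine le_trans ?_ (card_trSum_eq_zero_le (F := F) ht hq)
        refine Finset.card_le_card_of_injOn (fun x ↦ x - y) ?_ (sub_left_injective.injOn)
        intro x hx
        have hx' := (Finset.mem_filter.1 hx).2
        have := trSum_add (p := p) t (n / t) (x - y) y
        rw [sub_add_cancel, hx', right_eq_add] at this
        simpa using this)
    have himg : (Finset.image (trSum p t (n / t)) (Finset.univ : Finset F)).card
        ≤ (fixedSet p F t).card :=
      Finset.card_le_card (Finset.image_subset_iff.2 fun x _ ↦ trSum_mem_fixedSet hF htn x)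
    rw [Finset.card_univ, hF] at key
    have hsplit : p ^ n = p ^ (t * (n / t - 1)) * p ^ t := by
      rw [← pow_add, ← Nat.mul_add_one, Nat.sub_add_cancel hq, Nat.mul_div_cancel' htn]
    have := key.trans (Nat.mul_le_mul_left _ himg)
    rw [hsplit] at this
    exact Nat.le_of_mul_le_mul_left this (pow_pos (by omega) _)

variable [Algebra (ZMod p) F]

/-- The canonical additive character `x ↦ exp (2πi Tr(x) / p)` of `F`. -/
def canonicalChar (p : ℕ) [Fact p.Prime] (F : Type) [Field F] [Fintype F] [Algebra (ZMod p) F] :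
    AddChar F ℂ :=
  ZMod.stdAddChar.compAddMonoidHom (Algebra.trace (ZMod p) F).toAddMonoidHom

local notation "ψ" => canonicalChar p F

omit [CharP F p] in
theorem algebraMap_trace (hF : Fintype.card F = p ^ n) (x : F) :
    algebraMap (ZMod p) F (Algebra.trace (ZMod p) F x) = trSum p 1 n x := by
  have hr : Module.finrank (ZMod p) F = n := by
    have h := Module.card_eq_pow_finrank (K := ZMod p) (V := F)
    rw [hF, ZMod.card] at h
    exact (Nat.pow_right_injective (Fact.out : p.Prime).two_le h).symm
  rw [FiniteField.algebraMap_trace_eq_sum_pow, hr, Nat.card_zmod]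
  simp [trSum]

omit [CharP F p] in
theorem canonicalChar_eq_one_iff (hF : Fintype.card F = p ^ n) (x : F) :
    ψ x = 1 ↔ trSum p 1 n x = 0 := by
  rw [← algebraMap_trace hF, map_eq_zero_iff _ (algebraMap (ZMod p) F).injective]
  change ZMod.stdAddChar (Algebra.trace (ZMod p) F x) = 1 ↔ _
  rw [← AddChar.map_zero_eq_one (ZMod.stdAddChar (N := p)), ZMod.injective_stdAddChar.eq_iff]

theorem canonicalChar_frob (hF : Fintype.card F = p ^ n) (j : ℕ) (x : F) :
    ψ (frob p j x) = ψ x := by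
  induction j with
  | zero => rw [frob_zero]
  | succ j ih =>
    rw [← ih, add_comm, ← frob_frob]
    generalize frob p j x = y
    change ZMod.stdAddChar (Algebra.trace (ZMod p) F _) = ZMod.stdAddChar (Algebra.trace _ F _)
    congr 1
    apply (algebraMap (ZMod p) F).injective
    rw [algebraMap_trace hF, algebraMap_trace hF, ← sub_eq_zero]
    have h := frob_trSum_sub (p := p) 1 n y
    rw [one_mul, frob_card hF, sub_self] at h
    rw [← h]
    simp [trSum_eq, frob_frob, add_comm]

omit [Algebra (ZMod p) F] in
theorem trSum_one_eq {t : ℕ} (htn : t ∣ n) {c : F} (hc : c ∈ fixedSet p F t) (h : F) :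
    trSum p 1 n (c * h) = trSum p 1 t (c * trSum p t (n / t) h) := by
  rw [← trSum_mul _ (mem_fixedSet.1 hc)]
  have := trSum_trSum (p := p) 1 t (n / t) (c * h)
  rw [one_mul, Nat.mul_div_cancel' htn] at this
  exact this.symm

theorem canonicalChar_mul_eq_one (hF : Fintype.card F = p ^ n) {t : ℕ} (htn : t ∣ n) {c : F}
    (hc : c ∈ fixedSet p F t) {h : F} (h0 : trSum p t (n / t) h = 0) : ψ (c * h) = 1 := by
  rw [canonicalChar_eq_one_iff hF, trSum_one_eq htn hc, h0, mul_zero]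
  simp [trSum_eq]

/-- Orthogonality of the canonical character on the subfield with `p^t` elements. -/
theorem sum_fixedSet_canonicalChar (hF : Fintype.card F = p ^ n) {t : ℕ} (ht : 0 < t)
    (htn : t ∣ n) (h : F) :
    ∑ c ∈ fixedSet p F t, ψ (c * h) = if trSum p t (n / t) h = 0 then (p : ℂ) ^ t else 0 := by
  split_ifs with h0
  · rw [Finset.sum_congr rfl (g := fun _ ↦ (1 : ℂ)), Finset.sum_const, card_fixedSet hF ht htn]
    · simp
    · exact fun c hc ↦ canonicalChar_mul_eq_one hF htn hc h0
  · obtain ⟨c₀, hc₀, hne⟩ : ∃ c ∈ fixedSet p F t, ψ (c * h) ≠ 1 := by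
      by_contra! hall
      have hsub : (fixedSet p F t).image (fun c ↦ c * trSum p t (n / t) h) ⊆
          Finset.univ.filter fun x : F ↦ trSum p 1 t x = 0 := by
        intro x hx
        obtain ⟨c, hc, rfl⟩ := Finset.mem_image.1 hx
        have := (canonicalChar_eq_one_iff hF _).1 (hall c hc)
        rw [trSum_one_eq htn hc] at this
        simpa using this
      have hle := (Finset.card_le_card hsub).trans (card_trSum_eq_zero_le one_pos ht)
      rw [Finset.card_image_of_injective _ (mul_left_injective₀ h0), card_fixedSet hF ht htn,
        one_mul] at hle
      have := Nat.pow_lt_pow_right (Fact.out : p.Prime).one_lt (show t - 1 < t by omega)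
      omega
    have hshift : ∑ c ∈ fixedSet p F t, ψ (c * h) = ψ (c₀ * h) * ∑ c ∈ fixedSet p F t, ψ (c * h) := by
      rw [Finset.mul_sum]
      symm
      refine Finset.sum_bij' (fun c _ ↦ c₀ + c) (fun c _ ↦ c - c₀) ?_ ?_ ?_ ?_ ?_
      · intro c hc
        simp only [mem_fixedSet, map_add] at *
        rw [hc, hc₀]
      · intro c hc
        simp only [mem_fixedSet, map_sub] at *
        rw [hc, hc₀]
      · simp
      · simp
      · intro c _
        rw [add_mul, AddChar.map_add_eq_mul]
    have : (1 - ψ (c₀ * h)) * ∑ c ∈ fixedSet p F t, ψ (c * h) = 0 := by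
      rw [sub_mul, one_mul, ← hshift, sub_self]
    exact (mul_eq_zero.1 this).resolve_left (sub_ne_zero.2 hne.symm)

theorem sum_canonicalChar_mul (hF : Fintype.card F = p ^ n) (h : F) :
    ∑ c : F, ψ (c * h) = if h = 0 then (p : ℂ) ^ n else 0 := by
  have hn := card_pos_exponent hF
  have := sum_fixedSet_canonicalChar hF hn dvd_rfl h
  rw [Nat.div_self hn] at this
  have huniv : fixedSet p F n = Finset.univ := by
    ext x; simp [mem_fixedSet, frob_card hF]
  simpa [huniv, trSum] using this

end Character

section WeilSum

variable {p m n k d : ℕ} [Fact p.Prime] {F : Type} [Field F] [Fintype F] [CharP F p]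

/-- The standing assumptions on the parameters; `fixed_of_frob_eq` is the only consequence
of `gcd (m + k, 2 k) = d` that is needed. -/
structure Admissible (p m n k d : ℕ) [Fact p.Prime] (F : Type) [Field F] [Fintype F] [CharP F p] :
    Prop where
  ne_two : p ≠ 2
  card : Fintype.card F = p ^ n
  n_eq : n = 2 * m
  k_le : k ≤ n
  d_dvd_m : d ∣ m
  d_dvd_k : d ∣ k
  two_dvd_d : 2 ∣ d
  fixed_of_frob_eq : ∀ x : F, frob p k x = frob p m x → frob p d x = x

namespace Admissible

theorem n_pos (H : Admissible p m n k d F) : 0 < n := card_pos_exponent H.card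

theorem m_pos (H : Admissible p m n k d F) : 0 < m := by
  have := H.n_pos; have := H.n_eq; omega

theorem d_pos (H : Admissible p m n k d F) : 0 < d := Nat.pos_of_dvd_of_pos H.d_dvd_m H.m_pos

theorem m_dvd_n (H : Admissible p m n k d F) : m ∣ n := H.n_eq ▸ dvd_mul_left m 2

theorem d_dvd_n (H : Admissible p m n k d F) : d ∣ n := H.d_dvd_m.trans H.m_dvd_n

theorem two_ne_zero (H : Admissible p m n k d F) : (2 : F) ≠ 0 := by
  have := CharP.cast_eq_zero_iff F p 2
  intro h
  have h2 : p ∣ 2 := this.1 (by exact_mod_cast h)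
  exact H.ne_two ((Nat.prime_dvd_prime_iff_eq Fact.out Nat.prime_two).1 h2)

theorem frob_n (H : Admissible p m n k d F) (x : F) : frob p n x = x := frob_card H.card x

theorem frob_m_frob_m (H : Admissible p m n k d F) (x : F) : frob p m (frob p m x) = x := by
  rw [frob_frob, ← two_mul, ← H.n_eq, H.frob_n]

theorem frob_k_frob_sub (H : Admissible p m n k d F) (x : F) :
    frob p k (frob p (n - k) x) = x := by
  rw [frob_frob, Nat.add_sub_cancel' H.k_le, H.frob_n]

theorem frob_sub_frob_k (H : Admissible p m n k d F) (x : F) :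
    frob p (n - k) (frob p k x) = x := by
  rw [frob_frob, Nat.sub_add_cancel H.k_le, H.frob_n]

/-- Elements of the subfield with `p^t` elements are squares in the one with `p^d` elements. -/
theorem exists_sq_eq (H : Admissible p m n k d F) {t : ℕ} (h2t : 2 * t ∣ d) {c : F}
    (hc : c ∈ fixedSet p F t) (hc0 : c ≠ 0) : ∃ e ∈ fixedSet p F d, e ≠ 0 ∧ e * e = c := by
  have hp := (Fact.out : p.Prime).one_lt
  rw [mem_fixedSet] at hc
  have hodd : p % 2 = 1 := (Fact.out : p.Prime).mod_two_eq_one_iff_ne_two.2 H.ne_two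
  have hsq : IsSquare c := by
    rw [FiniteField.isSquare_iff (by rw [ringChar.eq F p]; exact H.ne_two) hc0, H.card]
    have hc1 : c ^ (p ^ t - 1) = 1 := by
      have : c ^ (p ^ t - 1) * c = 1 * c := by
        rw [← pow_succ, Nat.sub_add_cancel (Nat.pos_of_ne_zero (by positivity)), one_mul,
          ← frob_apply, hc]
      exact mul_right_cancel₀ hc0 this
    obtain ⟨s, hs⟩ : p ^ (2 * t) - 1 ∣ p ^ n - 1 := by
      obtain ⟨r, hr⟩ := h2t.trans H.d_dvd_n
      rw [hr, pow_mul p (2 * t) r]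
      simpa only [one_pow] using Nat.sub_dvd_pow_sub_pow (p ^ (2 * t)) 1 r
    obtain ⟨l, hl⟩ : Odd (p ^ t) := (Nat.odd_iff.2 hodd).pow
    have h1 : p ^ (2 * t) - 1 = 2 * ((p ^ t - 1) * (l + 1)) := by
      rw [two_mul, pow_add, hl, Nat.add_sub_cancel]
      rw [show (2 * l + 1) * (2 * l + 1) = 2 * (2 * l * (l + 1)) + 1 by ring, Nat.add_sub_cancel]
    have h2 : p ^ n / 2 = (p ^ t - 1) * (l + 1) * s := by
      have : 0 < p ^ n := by positivity
      rw [h1, mul_assoc] at hs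
      omega
    rw [h2, mul_assoc, pow_mul, hc1, one_pow]
  obtain ⟨e, rfl⟩ := hsq
  have he0 : e ≠ 0 := by rintro rfl; simp at hc0
  refine ⟨e, mem_fixedSet.2 (frob_of_dvd h2t ?_), he0, rfl⟩
  rw [map_mul] at hc
  rw [two_mul, ← frob_frob]
  rcases mul_self_eq_mul_self_iff.1 hc with h | h <;> simp [h]

theorem exists_sq_eq_neg_one (H : Admissible p m n k d F) :
    ∃ i ∈ fixedSet p F d, i ≠ 0 ∧ i * i = -1 :=
  H.exists_sq_eq (t := 1) H.two_dvd_d (by simp [mem_fixedSet]) (by simp)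

theorem exists_norm_eq (H : Admissible p m n k d F) {z : F} (hz : z ∈ fixedSet p F m)
    (hz0 : z ≠ 0) : ∃ e, e ≠ 0 ∧ frob p m e * e = z := by
  obtain ⟨g, hg⟩ := IsCyclic.exists_generator (α := Fˣ)
  obtain ⟨j, hj⟩ := (mem_powers_iff_mem_zpowers (y := Units.mk0 z hz0)).2 (hg _)
  have hord : orderOf g = p ^ n - 1 := by
    rw [orderOf_eq_card_of_forall_mem_zpowers hg, Nat.card_eq_fintype_card, Fintype.card_units,
      H.card]
  have hp := (Fact.out : p.Prime).pos
  have hm1 : 1 ≤ p ^ m := Nat.pos_of_ne_zero (by positivity)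
  have hz1 : g ^ (j * (p ^ m - 1)) = 1 := by
    rw [pow_mul, show g ^ j = Units.mk0 z hz0 from hj]
    ext
    have : z ^ (p ^ m - 1) * z = 1 * z := by
      rw [← pow_succ, Nat.sub_add_cancel hm1, one_mul, ← frob_apply, mem_fixedSet.1 hz]
    simpa using mul_right_cancel₀ hz0 this
  have hdvd := orderOf_dvd_of_pow_eq_one hz1
  have hfac : p ^ n - 1 = (p ^ m + 1) * (p ^ m - 1) := by
    rw [H.n_eq, mul_comm 2 m, pow_mul, ← Nat.sq_sub_sq, one_pow]
  have hlt : 0 < p ^ m - 1 :=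
    Nat.sub_pos_of_lt (Nat.one_lt_pow H.m_pos.ne' (Fact.out : p.Prime).one_lt)
  rw [hord, hfac] at hdvd
  obtain ⟨s, rfl⟩ := Nat.dvd_of_mul_dvd_mul_right hlt hdvd
  refine ⟨((g ^ s : Fˣ) : F), Units.ne_zero _, ?_⟩
  have : ((g ^ ((p ^ m + 1) * s) : Fˣ) : F) = z := by
    rw [show g ^ ((p ^ m + 1) * s) = Units.mk0 z hz0 from hj]; rfl
  rw [← this, frob_apply, ← pow_succ]
  push_cast
  rw [← pow_mul, mul_comm]

end Admissible

/-- The quadratic form attached to `(α, β)`, with values in `F`. -/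
def form (p m k : ℕ) [Fact p.Prime] {F : Type} [Field F] [CharP F p] (α β x : F) : F :=
  2⁻¹ * α * (frob p m x * x) + β * (frob p k x * x)

/-- The linear map whose kernel is the radical of the quadratic form attached to `(α, β)`. -/
def radMap (p m n k : ℕ) [Fact p.Prime] {F : Type} [Field F] [CharP F p] (α β x : F) : F :=
  α * frob p m x + β * frob p k x + frob p (n - k) (β * x)

/-- The radical of the quadratic form attached to `(α, β)`. -/
def radical (p m n k : ℕ) [Fact p.Prime] {F : Type} [Field F] [Fintype F] [CharP F p] (α β : F) :
    Finset F :=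
  Finset.univ.filter fun x ↦ radMap p m n k α β x = 0

variable [Algebra (ZMod p) F]

/-- The Weil sum of the quadratic form attached to `(α, β)`. -/
def weilSum (p m k : ℕ) [Fact p.Prime] {F : Type} [Field F] [Fintype F] [CharP F p]
    [Algebra (ZMod p) F] (α β : F) : ℂ :=
  ∑ x : F, canonicalChar p F (form p m k α β x)

local notation "ψ" => canonicalChar p F

namespace Admissible

theorem char_form_add (H : Admissible p m n k d F) {α : F} (hα : α ∈ fixedSet p F m) (β x y : F) :
    ψ (form p m k α β (x + y)) =
      ψ (form p m k α β x) * ψ (form p m k α β y) * ψ (y * radMap p m n k α β x) := by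
  have h1 : form p m k α β (x + y) = form p m k α β x + form p m k α β y +
      (2⁻¹ * α * frob p m x * y + β * frob p k x * y) + 2⁻¹ * α * x * frob p m y
      + β * x * frob p k y := by
    simp only [form, map_add]; ring
  have h2 : y * radMap p m n k α β x = (2⁻¹ * α * frob p m x * y + β * frob p k x * y) +
      frob p m (2⁻¹ * α * x * frob p m y) + frob p (n - k) (β * x * frob p k y) := by
    simp only [radMap, map_mul, map_inv₀, map_ofNat, H.frob_m_frob_m, H.frob_sub_frob_k,
      mem_fixedSet.1 hα]
    have := H.two_ne_zero
    field_simp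
    ring
  rw [h1, h2]
  simp only [AddChar.map_add_eq_mul, canonicalChar_frob H.card]
  ring

theorem weilSum_mul_sq (H : Admissible p m n k d F) {e : F} (he : e ∈ fixedSet p F d)
    (he0 : e ≠ 0) (α β : F) : weilSum p m k (e * e * α) (e * e * β) = weilSum p m k α β := by
  unfold weilSum
  conv_rhs => rw [← Equiv.sum_comp (Equiv.mulLeft₀ e he0)]
  refine Finset.sum_congr rfl fun x _ ↦ ?_
  congr 1
  rw [mem_fixedSet] at he
  change _ = form p m k α β (e * x)
  simp only [form, map_mul, frob_of_dvd H.d_dvd_m he, frob_of_dvd H.d_dvd_k he]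
  ring

theorem weilSum_neg (H : Admissible p m n k d F) (α β : F) :
    weilSum p m k (-α) (-β) = weilSum p m k α β := by
  obtain ⟨i, hi, hi0, hii⟩ := H.exists_sq_eq_neg_one
  rw [← H.weilSum_mul_sq hi hi0 α β, hii, neg_one_mul, neg_one_mul]

theorem weilSum_sq (H : Admissible p m n k d F) {α : F} (hα : α ∈ fixedSet p F m) (β : F) :
    weilSum p m k α β ^ 2 = (p : ℂ) ^ n * (radical p m n k α β).card := by
  have hrad : ∀ x ∈ radical p m n k α β, ψ (form p m k α β x) = 1 := by
    intro x hx
    obtain ⟨y, rfl⟩ : ∃ y, x = y + y := ⟨2⁻¹ * x, by have := H.two_ne_zero; field_simp; ring⟩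
    have hy : radMap p m n k α β y = 0 := by
      have h2 : 2 * radMap p m n k α β y = 0 := by
        rw [← (Finset.mem_filter.1 hx).2]; simp only [radMap, mul_add, map_add]; ring
      exact (mul_eq_zero.1 h2).resolve_left H.two_ne_zero
    have h1 := H.char_form_add hα β y (-y)
    have h2 := H.char_form_add hα β y y
    rw [hy, mul_zero, AddChar.map_zero_eq_one, mul_one] at h1 h2
    have heven : form p m k α β (-y) = form p m k α β y := by simp [form]
    rw [h2, ← heven]
    nth_rw 1 [heven]
    rw [← h1]
    simp [form]
  calc weilSum p m k α β ^ 2 = weilSum p m k α β * weilSum p m k (-α) (-β) := by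
        rw [H.weilSum_neg, sq]
    _ = ∑ y : F, ∑ x : F, ψ (form p m k α β (x + y)) * ψ (form p m k (-α) (-β) y) := by
        rw [weilSum, weilSum, Finset.sum_mul_sum, Finset.sum_comm]
        refine Finset.sum_congr rfl fun y _ ↦ ?_
        rw [← Equiv.sum_comp (Equiv.addRight y)]
        rfl
    _ = ∑ x : F, ψ (form p m k α β x) * ∑ y : F, ψ (y * radMap p m n k α β x) := by
        rw [Finset.sum_comm]
        refine Finset.sum_congr rfl fun x _ ↦ ?_
        rw [Finset.mul_sum]
        refine Finset.sum_congr rfl fun y _ ↦ ?_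
        have : form p m k (-α) (-β) y = -form p m k α β y := by simp only [form]; ring
        rw [H.char_form_add hα, this, AddChar.map_neg_eq_inv]
        have : ψ (form p m k α β y) ≠ 0 := (AddChar.val_isUnit _ _).ne_zero
        field_simp
    _ = ∑ x ∈ radical p m n k α β, ψ (form p m k α β x) * (p : ℂ) ^ n := by
        rw [radical, Finset.sum_filter]
        refine Finset.sum_congr rfl fun x _ ↦ ?_
        rw [sum_canonicalChar_mul H.card]
        split_ifs <;> simp
    _ = _ := by
        rw [Finset.sum_congr rfl fun x hx ↦ by rw [hrad x hx, one_mul], Finset.sum_const,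
          nsmul_eq_mul, mul_comm]

theorem sum_char_norm (H : Admissible p m n k d F) {b : F} (hb : b ∈ fixedSet p F m)
    (hb0 : b ≠ 0) : ∑ y : F, ψ (b * (frob p m y * y)) = -(p : ℂ) ^ m := by
  have hconst : ∀ b ∈ fixedSet p F m, b ≠ 0 →
      ∑ y : F, ψ (b * (frob p m y * y)) = ∑ y : F, ψ (frob p m y * y) := by
    intro b hb hb0
    obtain ⟨e, he0, rfl⟩ := H.exists_norm_eq hb hb0
    conv_rhs => rw [← Equiv.sum_comp (Equiv.mulLeft₀ e he0)]
    refine Finset.sum_congr rfl fun x _ ↦ ?_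
    congr 1
    change _ = frob p m (e * x) * (e * x)
    rw [map_mul]; ring
  have htot : ∑ b ∈ fixedSet p F m, ∑ y : F, ψ (b * (frob p m y * y)) = (p : ℂ) ^ m := by
    rw [Finset.sum_comm, Finset.sum_eq_single 0]
    · simp [card_fixedSet H.card H.m_pos H.m_dvd_n]
    · intro y _ hy
      rw [sum_fixedSet_canonicalChar H.card H.m_pos H.m_dvd_n, if_neg]
      have : n / m = 2 := by rw [H.n_eq, Nat.mul_div_cancel _ H.m_pos]
      rw [this, trSum_eq]
      simp only [Finset.sum_range_succ, Finset.sum_range_zero, mul_zero, frob_zero, mul_one,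
        map_mul, H.frob_m_frob_m, zero_add, mul_comm y, ← two_mul]
      simp [H.two_ne_zero, hy]
    · simp
  have h0 : (0 : F) ∈ fixedSet p F m := by simp [mem_fixedSet]
  rw [← Finset.add_sum_erase _ _ h0,
    Finset.sum_congr rfl fun b hb ↦
      hconst b (Finset.mem_of_mem_erase hb) (Finset.ne_of_mem_erase hb),
    Finset.sum_const, Finset.card_erase_of_mem h0, card_fixedSet H.card H.m_pos H.m_dvd_n] at htot
  have hlt := Nat.one_lt_pow H.m_pos.ne' (Fact.out : p.Prime).one_lt
  rw [hconst b hb hb0]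
  simp only [zero_mul, AddChar.map_zero_eq_one, Finset.sum_const, Finset.card_univ, H.card,
    nsmul_eq_mul, Nat.cast_sub hlt.le, mul_one, H.n_eq, two_mul, pow_add] at htot
  push_cast at htot
  have hne : (p : ℂ) ^ m - 1 ≠ 0 := sub_ne_zero.2 (by exact_mod_cast hlt.ne')
  apply mul_left_cancel₀ hne
  linear_combination htot

theorem sum_char_norm_add (H : Admissible p m n k d F) {b : F} (hb : b ∈ fixedSet p F m)
    (hb0 : b ≠ 0) {u : F} (hu : u ∈ fixedSet p F d) :
    ∑ y : F, ψ (-(2⁻¹ * b) * (frob p m y * y) + u * y) =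
      -(p : ℂ) ^ m * ψ (u * u * (2⁻¹ * b⁻¹)) := by
  have h2 := H.two_ne_zero
  have hum : frob p m u = u := frob_of_dvd H.d_dvd_m (mem_fixedSet.1 hu)
  have hbm : frob p m b = b := mem_fixedSet.1 hb
  rw [← H.sum_char_norm (b := -(2⁻¹ * b)) (by simp [mem_fixedSet, hbm, map_ofNat]) (by simp [h2, hb0]),
    Finset.sum_mul, ← Equiv.sum_comp (Equiv.addRight (u * b⁻¹))]
  refine Finset.sum_congr rfl fun y _ ↦ ?_
  have h : -(2⁻¹ * b) * (frob p m (y + u * b⁻¹) * (y + u * b⁻¹)) + u * (y + u * b⁻¹) =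
      -(2⁻¹ * b) * (frob p m y * y) + u * u * (2⁻¹ * b⁻¹) + 2⁻¹ * u * y
        + -frob p m (2⁻¹ * u * y) := by
    simp only [map_add, map_mul, map_inv₀, map_ofNat, hum, hbm]
    field_simp
    ring
  change ψ (-(2⁻¹ * b) * (frob p m (y + u * b⁻¹) * (y + u * b⁻¹)) + u * (y + u * b⁻¹)) = _
  rw [h]
  simp only [AddChar.map_add_eq_mul, AddChar.map_neg_eq_inv, canonicalChar_frob H.card]
  rw [mul_assoc, mul_inv_cancel₀ (AddChar.val_isUnit _ _).ne_zero, mul_one]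

omit [Algebra (ZMod p) F] in
theorem frob_sub_eq_frob_m_iff (H : Admissible p m n k d F) (u : F) :
    frob p m u - frob p (n - k) u = 0 ↔ u ∈ fixedSet p F d := by
  rw [mem_fixedSet]
  constructor
  · intro h
    have h1 : frob p m (frob p k u) = u := by
      rw [frob_frob, add_comm, ← frob_frob, sub_eq_zero.1 h, H.frob_k_frob_sub]
    exact H.fixed_of_frob_eq u (by conv_rhs => rw [← h1, H.frob_m_frob_m])
  · intro h
    rw [frob_of_dvd H.d_dvd_m h, frob_of_dvd (Nat.dvd_sub H.d_dvd_n H.d_dvd_k) h, sub_self]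

/-- Summation over the image of `x ↦ x^{p^k} - x^{p^m}`, in terms of Fourier coefficients. -/
theorem sum_comp_frob_sub_frob (H : Admissible p m n k d F) (g : F → ℂ) :
    ∑ x : F, g (frob p k x - frob p m x) = ∑ u ∈ fixedSet p F d, ∑ y : F, g y * ψ (u * y) := by
  have hq : (p : ℂ) ^ n ≠ 0 := pow_ne_zero _ (by exact_mod_cast (Fact.out : p.Prime).ne_zero)
  have hinner : ∀ u : F, ∑ x : F, ψ (-(u * (frob p k x - frob p m x))) =
      if u ∈ fixedSet p F d then (p : ℂ) ^ n else 0 := by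
    intro u
    simp only [← H.frob_sub_eq_frob_m_iff]
    rw [← sum_canonicalChar_mul H.card]
    refine Finset.sum_congr rfl fun x _ ↦ ?_
    rw [show -(u * (frob p k x - frob p m x)) = u * frob p m x + -u * frob p k x by ring,
      show x * (frob p m u - frob p (n - k) u) =
        frob p m (u * frob p m x) + frob p (n - k) (-u * frob p k x) by
      simp only [map_mul, map_neg, H.frob_m_frob_m, H.frob_sub_frob_k]; ring,
      AddChar.map_add_eq_mul, AddChar.map_add_eq_mul, canonicalChar_frob H.card,
      canonicalChar_frob H.card]
  apply mul_left_cancel₀ hq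
  calc (p : ℂ) ^ n * ∑ x : F, g (frob p k x - frob p m x)
      = ∑ x : F, ∑ y : F, g y * ∑ u : F, ψ (u * (y - (frob p k x - frob p m x))) := by
        rw [Finset.mul_sum]
        refine Finset.sum_congr rfl fun x _ ↦ ?_
        rw [Finset.sum_eq_single (frob p k x - frob p m x)]
        · rw [sum_canonicalChar_mul H.card, if_pos (sub_self _), mul_comm]
        · intro y _ hy
          rw [sum_canonicalChar_mul H.card, if_neg (sub_ne_zero.2 hy), mul_zero]
        · simp
    _ = ∑ u : F, (∑ y : F, g y * ψ (u * y)) * ∑ x : F, ψ (-(u * (frob p k x - frob p m x))) := by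
        simp only [Finset.mul_sum]
        rw [Finset.sum_congr rfl fun x _ ↦ Finset.sum_comm, Finset.sum_comm]
        refine Finset.sum_congr rfl fun u _ ↦ Finset.sum_congr rfl fun x _ ↦ ?_
        rw [Finset.sum_mul]
        refine Finset.sum_congr rfl fun y _ ↦ ?_
        rw [mul_sub, sub_eq_add_neg, AddChar.map_add_eq_mul, mul_assoc]
    _ = _ := by
        simp only [hinner, mul_ite, mul_zero]
        rw [Finset.sum_ite_mem, Finset.univ_inter, Finset.mul_sum]
        exact Finset.sum_congr rfl fun u _ ↦ mul_comm _ _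

/-- The quadratic Gauss sum over the subfield with `p^d` elements, twisted by `z`. -/
def gaussSum (p d : ℕ) [Fact p.Prime] {F : Type} [Field F] [Fintype F] [CharP F p]
    [Algebra (ZMod p) F] (z : F) : ℂ :=
  ∑ c ∈ fixedSet p F d, canonicalChar p F (c * c * z)

theorem weilSum_of_one_mem_radical (H : Admissible p m n k d F) {b : F}
    (hb : b ∈ fixedSet p F m) (hb0 : b ≠ 0) :
    weilSum p m k (-(b + frob p (n - k) b)) b = -(p : ℂ) ^ m * gaussSum p d (2⁻¹ * b⁻¹) := by
  have h2 := H.two_ne_zero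
  have hbm : frob p m b = b := mem_fixedSet.1 hb
  calc weilSum p m k (-(b + frob p (n - k) b)) b
      = ∑ x : F, (fun y ↦ ψ (-(2⁻¹ * b) * (frob p m y * y))) (frob p k x - frob p m x) := by
        refine Finset.sum_congr rfl fun x _ ↦ ?_
        have h1 : form p m k (-(b + frob p (n - k) b)) b x =
            -(2⁻¹ * b) * (frob p m x * x) + 2⁻¹ * b * frob p k x * x
            + (-(2⁻¹ * frob p (n - k) b * (frob p m x * x))) + 2⁻¹ * b * frob p k x * x := by
          simp only [form]; field_simp; ring
        have h3 : -(2⁻¹ * b) * (frob p m (frob p k x - frob p m x) * (frob p k x - frob p m x)) =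
            -(2⁻¹ * b) * (frob p m x * x) + 2⁻¹ * b * frob p k x * x
            + frob p k (-(2⁻¹ * frob p (n - k) b * (frob p m x * x)))
            + frob p m (2⁻¹ * b * frob p k x * x) := by
          simp only [map_neg, map_mul, map_sub, map_inv₀, map_ofNat, H.frob_m_frob_m,
            H.frob_k_frob_sub, hbm]
          rw [frob_frob k m, frob_frob m k, add_comm k m]
          ring
        simp only [h1, h3, AddChar.map_add_eq_mul, canonicalChar_frob H.card]
    _ = _ := by
        refine (H.sum_comp_frob_sub_frob fun y ↦ ψ (-(2⁻¹ * b) * (frob p m y * y))).trans ?_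
        rw [gaussSum, Finset.mul_sum]
        refine Finset.sum_congr rfl fun u hu ↦ ?_
        rw [← H.sum_char_norm_add hb hb0 hu]
        exact Finset.sum_congr rfl fun y _ ↦ (AddChar.map_add_eq_mul _ _ _).symm

theorem gaussSum_of_trSum_eq_zero (H : Admissible p m n k d F) {z : F}
    (hz : trSum p d (n / d) z = 0) : gaussSum p d z = (p : ℂ) ^ d := by
  rw [gaussSum, Finset.sum_congr rfl (g := fun _ ↦ (1 : ℂ)), Finset.sum_const,
    card_fixedSet H.card H.d_pos H.d_dvd_n]
  · simp
  · intro c hc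
    refine canonicalChar_mul_eq_one H.card H.d_dvd_n ?_ hz
    rw [mem_fixedSet] at *
    rw [map_mul, hc]

theorem gaussSum_sq (H : Admissible p m n k d F) {z : F} (hz : trSum p d (n / d) z ≠ 0) :
    gaussSum p d z ^ 2 = (p : ℂ) ^ d := by
  obtain ⟨i, hi, hi0, hii⟩ := H.exists_sq_eq_neg_one
  rw [mem_fixedSet] at hi
  have hneg : ∑ c ∈ fixedSet p F d, ψ (-(c * c * z)) = gaussSum p d z := by
    refine Finset.sum_bij' (fun c _ ↦ i * c) (fun c _ ↦ i⁻¹ * c) ?_ ?_ ?_ ?_ ?_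
    · intro c hc; simp only [mem_fixedSet, map_mul] at *; rw [hc, hi]
    · intro c hc; simp only [mem_fixedSet, map_mul, map_inv₀] at *; rw [hc, hi]
    · intro c _; field_simp
    · intro c _; field_simp
    · intro c _
      congr 1
      linear_combination (-c * c * z) * hii
  calc gaussSum p d z ^ 2
      = ∑ c ∈ fixedSet p F d, ∑ u ∈ fixedSet p F d, ψ ((u + c) * (u + c) * z) * ψ (-(c * c * z)) := by
        rw [sq]
        nth_rw 2 [← hneg]
        rw [gaussSum, Finset.sum_mul_sum, Finset.sum_comm]
        refine Finset.sum_congr rfl fun c hc ↦ ?_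
        rw [mem_fixedSet] at hc
        refine Finset.sum_bij' (fun u _ ↦ u - c) (fun u _ ↦ u + c) ?_ ?_ ?_ ?_ ?_
        · intro u hu; simp only [mem_fixedSet, map_sub] at *; rw [hc, hu]
        · intro u hu; simp only [mem_fixedSet, map_add] at *; rw [hc, hu]
        · simp
        · simp
        · simp
    _ = ∑ u ∈ fixedSet p F d, ψ (u * u * z) * ∑ c ∈ fixedSet p F d, ψ (c * (2 * u * z)) := by
        rw [Finset.sum_comm]
        refine Finset.sum_congr rfl fun u _ ↦ ?_
        rw [Finset.mul_sum]
        refine Finset.sum_congr rfl fun c _ ↦ ?_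
        rw [← AddChar.map_add_eq_mul, ← AddChar.map_add_eq_mul]
        congr 1; ring
    _ = (p : ℂ) ^ d := by
        rw [Finset.sum_eq_single 0]
        · simp [card_fixedSet H.card H.d_pos H.d_dvd_n]
        · intro u hu hu0
          rw [sum_fixedSet_canonicalChar H.card H.d_pos H.d_dvd_n, if_neg, mul_zero]
          rw [mem_fixedSet] at hu
          rw [trSum_mul _ (by simp [hu, map_ofNat])]
          exact mul_ne_zero (mul_ne_zero H.two_ne_zero hu0) hz
        · simp [mem_fixedSet]

omit [Algebra (ZMod p) F] in
theorem trSum_of_mem_fixedSet (H : Admissible p m n k d F) {c : F} (hc : c ∈ fixedSet p F m) :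
    trSum p m (n / m) c = 2 * c := by
  have : n / m = 2 := by rw [H.n_eq, Nat.mul_div_cancel _ H.m_pos]
  rw [this, trSum_eq]
  simp [Finset.sum_range_succ, frob_zero, mem_fixedSet.1 hc, two_mul]

omit [Algebra (ZMod p) F] in
theorem norm_mem_fixedSet (H : Admissible p m n k d F) (x : F) :
    frob p m x * x ∈ fixedSet p F m := by
  rw [mem_fixedSet, map_mul, H.frob_m_frob_m, mul_comm]

omit [Algebra (ZMod p) F] [Fintype F] in
theorem norm_ne_zero {x : F} (hx : x ≠ 0) : frob p m x * x ≠ 0 :=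
  mul_ne_zero ((map_ne_zero _).2 hx) hx

omit [Algebra (ZMod p) F] in
theorem mem_fixedSet_of_mul_radMap (H : Admissible p m n k d F) {a b : F}
    (ha : a ∈ fixedSet p F m) (h : a + b + frob p (n - k) b = 0) : b ∈ fixedSet p F m := by
  have ha' := mem_fixedSet.1 ha
  set c := frob p m b - b with hc
  have h1 : frob p m (a + b + frob p (n - k) b) = 0 := by rw [h, map_zero]
  have h2 : c + frob p (n - k) c = 0 := by
    simp only [map_add, ha'] at h1
    rw [frob_frob, add_comm m, ← frob_frob] at h1
    rw [hc, map_sub]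
    linear_combination h1 - h
  have h3 : frob p k c = -c := by
    have := congr_arg (frob p k) h2
    rw [map_add, H.frob_k_frob_sub, map_zero] at this
    exact eq_neg_of_add_eq_zero_left this
  have h4 : frob p m c = -c := by rw [hc, map_sub, H.frob_m_frob_m, neg_sub]
  have h5 := frob_of_dvd H.d_dvd_m (H.fixed_of_frob_eq c (h3.trans h4.symm))
  have h6 : 2 * c = 0 := by rw [h4] at h5; linear_combination -h5
  rw [mem_fixedSet, ← sub_eq_zero]
  exact (mul_eq_zero.1 h6).resolve_left H.two_ne_zero

omit [Algebra (ZMod p) F] in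
theorem mul_radMap (H : Admissible p m n k d F) (α β x : F) :
    x * radMap p m n k α β x = α * (frob p m x * x) + β * (frob p k x * x) +
      frob p (n - k) (β * (frob p k x * x)) := by
  simp only [radMap, map_mul, H.frob_sub_frob_k]; ring

theorem weilSum_scale {x : F} (hx : x ≠ 0) (α β : F) :
    weilSum p m k (α * (frob p m x * x)) (β * (frob p k x * x)) = weilSum p m k α β := by
  unfold weilSum
  conv_rhs => rw [← Equiv.sum_comp (Equiv.mulLeft₀ x hx)]
  refine Finset.sum_congr rfl fun y _ ↦ ?_
  congr 1
  change _ = form p m k α β (x * y)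
  simp only [form, map_mul]
  ring

/-- The pairs `(α, β)` with `α` in the subfield with `p^m` elements. -/
def pairs (p m : ℕ) [Fact p.Prime] (F : Type) [Field F] [Fintype F] [CharP F p] :
    Finset (F × F) :=
  fixedSet p F m ×ˢ Finset.univ

/-- The pairs whose Weil sum takes the value `v`. -/
def pairsWith (p m k : ℕ) [Fact p.Prime] (F : Type) [Field F] [Fintype F] [CharP F p]
    [Algebra (ZMod p) F] (v : ℂ) : Finset (F × F) :=
  (pairs p m F).filter fun ab ↦ weilSum p m k ab.1 ab.2 = v

omit [Algebra (ZMod p) F] in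
theorem mem_pairs {ab : F × F} : ab ∈ pairs p m F ↔ frob p m ab.1 = ab.1 := by
  simp [pairs, mem_fixedSet]

/-- Double counting of pairs together with a nonzero element of the radical. -/
theorem sum_card_radical (H : Admissible p m n k d F) (v : ℂ) :
    ∑ ab ∈ pairsWith p m k F v, ((radical p m n k ab.1 ab.2).erase 0).card =
      ((fixedSet p F m).filter fun b ↦ weilSum p m k (-(b + frob p (n - k) b)) b = v).card *
        (p ^ n - 1) := by
  have hunits : (Finset.univ.erase (0 : F)).card = p ^ n - 1 := by
    rw [Finset.card_erase_of_mem (Finset.mem_univ _), Finset.card_univ, H.card]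
  rw [← hunits, ← Finset.card_product, ← Finset.card_sigma]
  refine Finset.card_bij' (fun s _ ↦ (s.1.2 * (frob p k s.2 * s.2), s.2))
    (fun r _ ↦ ⟨(-(r.1 + frob p (n - k) r.1) * (frob p m r.2 * r.2)⁻¹,
      r.1 * (frob p k r.2 * r.2)⁻¹), r.2⟩) ?_ ?_ ?_ ?_
  · rintro ⟨⟨α, β⟩, x⟩ hs
    simp only [Finset.mem_sigma, pairsWith, Finset.mem_filter, mem_pairs, Finset.mem_erase,
      radical, Finset.mem_univ, true_and] at hs
    obtain ⟨⟨hα, hv⟩, hx, hr⟩ := hs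
    have h := H.mul_radMap α β x
    rw [hr, mul_zero] at h
    have hmem : α * (frob p m x * x) ∈ fixedSet p F m := by
      rw [mem_fixedSet, map_mul, hα, mem_fixedSet.1 (H.norm_mem_fixedSet x)]
    simp only [Finset.mem_product, Finset.mem_filter, Finset.mem_erase, Finset.mem_univ, and_true]
    refine ⟨⟨H.mem_fixedSet_of_mul_radMap hmem h.symm, ?_⟩, hx⟩
    rw [← hv, ← weilSum_scale hx α β]
    congr 1
    linear_combination h
  · rintro ⟨b, x⟩ hs
    simp only [Finset.mem_product, Finset.mem_filter, Finset.mem_erase, Finset.mem_univ,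
      and_true, mem_fixedSet] at hs
    obtain ⟨⟨hb, hv⟩, hx⟩ := hs
    have hN := norm_ne_zero (p := p) (m := m) hx
    have hK := norm_ne_zero (p := p) (m := k) hx
    simp only [Finset.mem_sigma, pairsWith, Finset.mem_filter, mem_pairs, Finset.mem_erase,
      radical, Finset.mem_univ, true_and]
    refine ⟨⟨?_, ?_⟩, hx, ?_⟩
    · rw [map_mul, map_inv₀, mem_fixedSet.1 (H.norm_mem_fixedSet x), map_neg, map_add, hb,
        frob_frob, add_comm m, ← frob_frob, hb]
    · rw [← weilSum_scale hx, inv_mul_cancel_right₀ hN, inv_mul_cancel_right₀ hK, hv]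
    · have := H.mul_radMap (-(b + frob p (n - k) b) * (frob p m x * x)⁻¹)
        (b * (frob p k x * x)⁻¹) x
      rw [inv_mul_cancel_right₀ hN, inv_mul_cancel_right₀ hK] at this
      refine (mul_eq_zero.1 (this.trans ?_)).resolve_left hx
      ring
  · rintro ⟨⟨α, β⟩, x⟩ hs
    simp only [Finset.mem_sigma, pairsWith, Finset.mem_filter, mem_pairs, Finset.mem_erase,
      radical, Finset.mem_univ, true_and] at hs
    obtain ⟨⟨hα, hv⟩, hx, hr⟩ := hs
    have h := H.mul_radMap α β x
    rw [hr, mul_zero] at h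
    have hN := norm_ne_zero (p := p) (m := m) hx
    have hK := norm_ne_zero (p := p) (m := k) hx
    have h1 : -(β * (frob p k x * x) + frob p (n - k) (β * (frob p k x * x))) =
      α * (frob p m x * x) := by linear_combination h
    simp only [h1, mul_inv_cancel_right₀ hN, mul_inv_cancel_right₀ hK]
  · rintro ⟨b, x⟩ hs
    simp only [Finset.mem_product, Finset.mem_erase, Finset.mem_univ, and_true] at hs
    simp only [inv_mul_cancel_right₀ (norm_ne_zero (p := p) (m := k) hs.2)]

theorem weilSum_zero (H : Admissible p m n k d F) : weilSum p m k (0 : F) 0 = (p : ℂ) ^ n := by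
  simp [weilSum, form, H.card]

theorem gaussSum_mem (H : Admissible p m n k d F) (z : F) :
    gaussSum p d z = ((p ^ d : ℤ) : ℂ) ∨ gaussSum p d z = ((p ^ (d / 2) : ℤ) : ℂ) ∨
      gaussSum p d z = ((-p ^ (d / 2) : ℤ) : ℂ) := by
  push_cast
  by_cases hz : trSum p d (n / d) z = 0
  · exact Or.inl (H.gaussSum_of_trSum_eq_zero hz)
  · right
    rw [← sq_eq_sq_iff_eq_or_eq_neg, H.gaussSum_sq hz, ← pow_mul, Nat.div_mul_cancel H.two_dvd_d]

theorem weilSum_mem (H : Admissible p m n k d F) {α β : F} (hα : α ∈ fixedSet p F m) :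
    (α = 0 ∧ β = 0) ∨ (weilSum p m k α β = (p : ℂ) ^ m ∨ weilSum p m k α β = -(p : ℂ) ^ m) ∨
      ∃ z : F, weilSum p m k α β = -(p : ℂ) ^ m * gaussSum p d z := by
  by_cases hr : ∃ x, x ≠ 0 ∧ radMap p m n k α β x = 0
  · obtain ⟨x, hx, hr⟩ := hr
    have h := H.mul_radMap α β x
    rw [hr, mul_zero] at h
    have hmem : α * (frob p m x * x) ∈ fixedSet p F m := by
      rw [mem_fixedSet, map_mul, mem_fixedSet.1 hα, mem_fixedSet.1 (H.norm_mem_fixedSet x)]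
    have hb := H.mem_fixedSet_of_mul_radMap hmem h.symm
    have hN := norm_ne_zero (p := p) (m := m) hx
    have hK := norm_ne_zero (p := p) (m := k) hx
    by_cases hβ : β = 0
    · left
      simp only [hβ, zero_mul, map_zero, add_zero] at h
      exact ⟨(mul_eq_zero.1 h.symm).resolve_right hN, hβ⟩
    · right; right
      refine ⟨2⁻¹ * (β * (frob p k x * x))⁻¹, ?_⟩
      rw [← H.weilSum_of_one_mem_radical hb (mul_ne_zero hβ hK), ← weilSum_scale hx α β]
      congr 1
      linear_combination -h
  · right; left
    push Not at hr
    have hrad : radical p m n k α β = {0} := by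
      ext x
      simp only [radical, Finset.mem_filter, Finset.mem_univ, true_and, Finset.mem_singleton]
      refine ⟨fun h ↦ by_contra fun hx ↦ hr x hx h, ?_⟩
      rintro rfl; simp [radMap]
    rw [← sq_eq_sq_iff_eq_or_eq_neg, H.weilSum_sq hα, hrad, H.n_eq]
    simp only [Finset.card_singleton, Nat.cast_one, mul_one]
    ring

theorem sum_weilSum (H : Admissible p m n k d F) :
    ∑ ab ∈ pairs p m F, weilSum p m k ab.1 ab.2 = (p : ℂ) ^ m * (p : ℂ) ^ n := by
  rw [pairs, Finset.sum_product, Finset.sum_congr rfl (g := fun _ ↦ (p : ℂ) ^ n),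
    Finset.sum_const, card_fixedSet H.card H.m_pos H.m_dvd_n, nsmul_eq_mul, Nat.cast_pow]
  intro α _
  simp only [weilSum, form, AddChar.map_add_eq_mul]
  rw [Finset.sum_comm, Finset.sum_eq_single 0]
  · simp [H.card]
  · intro x _ hx
    rw [← Finset.mul_sum, sum_canonicalChar_mul H.card,
      if_neg (norm_ne_zero (p := p) (m := k) hx), mul_zero]
  · simp

theorem card_trSum_eq_zero (H : Admissible p m n k d F) :
    p ^ d * ((fixedSet p F m).filter fun z ↦ trSum p d (n / d) z = 0).card = p ^ m := by
  have h : ∑ z ∈ fixedSet p F m, ∑ c ∈ fixedSet p F d, ψ (c * z) = (p : ℂ) ^ m := by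
    rw [Finset.sum_comm, Finset.sum_eq_single 0]
    · simp [card_fixedSet H.card H.m_pos H.m_dvd_n]
    · intro c hc hc0
      simp only [mul_comm c]
      rw [sum_fixedSet_canonicalChar H.card H.m_pos H.m_dvd_n, H.trSum_of_mem_fixedSet,
        if_neg (mul_ne_zero H.two_ne_zero hc0)]
      exact mem_fixedSet.2 (frob_of_dvd H.d_dvd_m (mem_fixedSet.1 hc))
    · simp [mem_fixedSet]
  simp only [sum_fixedSet_canonicalChar H.card H.d_pos H.d_dvd_n] at h
  rw [← Finset.sum_filter, Finset.sum_const, nsmul_eq_mul, mul_comm] at h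
  exact_mod_cast h

theorem sum_gaussSum (H : Admissible p m n k d F) :
    ∑ z ∈ fixedSet p F m, gaussSum p d z = (p : ℂ) ^ m := by
  simp only [gaussSum]
  rw [Finset.sum_comm, Finset.sum_eq_single 0]
  · simp [card_fixedSet H.card H.m_pos H.m_dvd_n]
  · intro c hc hc0
    simp only [mul_comm (c * c)]
    rw [sum_fixedSet_canonicalChar H.card H.m_pos H.m_dvd_n, H.trSum_of_mem_fixedSet,
      if_neg (mul_ne_zero H.two_ne_zero (mul_ne_zero hc0 hc0))]
    have := frob_of_dvd H.d_dvd_m (mem_fixedSet.1 hc)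
    rw [mem_fixedSet, map_mul, this]
  · simp [mem_fixedSet]

theorem card_filter_weilSum_eq (H : Admissible p m n k d F) {w : ℂ}
    (hw : (p : ℂ) ^ n ≠ -(p : ℂ) ^ m * w) :
    ((fixedSet p F m).filter
      fun b ↦ weilSum p m k (-(b + frob p (n - k) b)) b = -(p : ℂ) ^ m * w).card =
    (((fixedSet p F m).erase 0).filter fun z ↦ gaussSum p d z = w).card := by
  have hpm : -(p : ℂ) ^ m ≠ 0 :=
    neg_ne_zero.2 (pow_ne_zero _ (by exact_mod_cast (Fact.out : p.Prime).ne_zero))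
  have h2 := H.two_ne_zero
  have hval : ∀ b ∈ fixedSet p F m, b ≠ 0 →
      (weilSum p m k (-(b + frob p (n - k) b)) b = -(p : ℂ) ^ m * w ↔
        gaussSum p d (2⁻¹ * b⁻¹) = w) := by
    intro b hb hb0
    rw [H.weilSum_of_one_mem_radical hb hb0]
    exact ⟨fun h ↦ mul_left_cancel₀ hpm h, fun h ↦ by rw [h]⟩
  have hmem : ∀ b ∈ fixedSet p F m, 2⁻¹ * b⁻¹ ∈ fixedSet p F m := by
    intro b hb
    simp only [mem_fixedSet, map_mul, map_inv₀, map_ofNat] at *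
    rw [hb]
  refine Finset.card_bij' (fun b _ ↦ 2⁻¹ * b⁻¹) (fun z _ ↦ 2⁻¹ * z⁻¹) ?_ ?_ ?_ ?_
  · intro b hb
    obtain ⟨hb, hv⟩ := Finset.mem_filter.1 hb
    have hb0 : b ≠ 0 := by
      rintro rfl
      rw [map_zero, add_zero, neg_zero, H.weilSum_zero] at hv
      exact hw hv
    simp only [Finset.mem_filter, Finset.mem_erase]
    exact ⟨⟨by simp [h2, hb0], hmem b hb⟩, (hval b hb hb0).1 hv⟩
  · intro z hz
    obtain ⟨hz, hv⟩ := Finset.mem_filter.1 hz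
    obtain ⟨hz0, hz⟩ := Finset.mem_erase.1 hz
    refine Finset.mem_filter.2 ⟨hmem z hz, (hval _ (hmem z hz) (by simp [h2, hz0])).2 ?_⟩
    rw [← hv]
    congr 1
    field_simp
  · intro b _
    field_simp
  · intro b _
    field_simp

theorem card_pairsWith_mul (H : Admissible p m n k d F) {w : ℂ}
    (hw : (p : ℂ) ^ n ≠ -(p : ℂ) ^ m * w) {s : ℕ} (hs : w ^ 2 = (p : ℂ) ^ s) :
    (pairsWith p m k F (-(p : ℂ) ^ m * w)).card * (p ^ s - 1) =
      (((fixedSet p F m).erase 0).filter fun z ↦ gaussSum p d z = w).card * (p ^ n - 1) := by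
  have hq : (p : ℂ) ^ n ≠ 0 := pow_ne_zero _ (by exact_mod_cast (Fact.out : p.Prime).ne_zero)
  rw [← H.card_filter_weilSum_eq hw, ← H.sum_card_radical, ← smul_eq_mul, ← Finset.sum_const]
  refine Finset.sum_congr rfl fun ab hab ↦ ?_
  rw [pairsWith, Finset.mem_filter, mem_pairs] at hab
  have h := H.weilSum_sq (mem_fixedSet.2 hab.1) ab.2
  rw [hab.2, mul_pow, hs, neg_sq, ← pow_mul, mul_comm m 2, ← H.n_eq] at h
  have hcard : (radical p m n k ab.1 ab.2).card = p ^ s := by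
    exact_mod_cast (mul_left_cancel₀ hq h).symm
  rw [Finset.card_erase_of_mem (by simp [radical, radMap]), hcard]

end Admissible

omit [Fact p.Prime] [Field F] [Fintype F] [CharP F p] [Algebra (ZMod p) F] in
theorem sum_eq_sum_mul_card {ι : Type} (s : Finset ι) (f : ι → ℂ) (t : Finset ℤ)
    (h : ∀ i ∈ s, ∃ v ∈ t, f i = (v : ℂ)) :
    (s.card : ℤ) = ∑ v ∈ t, ((s.filter fun i ↦ f i = (v : ℂ)).card : ℤ) ∧
      ∑ i ∈ s, f i = ((∑ v ∈ t, v * ((s.filter fun i ↦ f i = (v : ℂ)).card : ℤ) : ℤ) : ℂ) := by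
  choose! e he using h
  have hfil : ∀ v : ℤ, (s.filter fun i ↦ f i = (v : ℂ)) = s.filter fun i ↦ e i = v := by
    intro v
    refine Finset.filter_congr fun i hi ↦ ?_
    rw [(he i hi).2, Int.cast_inj]
  simp only [hfil]
  constructor
  · exact_mod_cast Finset.card_eq_sum_card_fiberwise fun i hi ↦ (he i hi).1
  · rw [← Finset.sum_fiberwise_of_maps_to fun i hi ↦ (he i hi).1]
    push_cast
    refine Finset.sum_congr rfl fun v _ ↦ ?_
    rw [Finset.sum_congr rfl (g := fun _ ↦ (v : ℂ)), Finset.sum_const, nsmul_eq_mul, mul_comm]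
    intro i hi
    obtain ⟨hi', rfl⟩ := Finset.mem_filter.1 hi
    exact (he i hi').2

namespace Admissible

omit [Algebra (ZMod p) F] in
theorem pow_bounds (H : Admissible p m n k d F) :
    1 < (p : ℤ) ^ (d / 2) ∧ (p : ℤ) ^ d = (p : ℤ) ^ (d / 2) * (p : ℤ) ^ (d / 2) ∧
      0 < (p : ℤ) ^ (m - d) ∧ (p : ℤ) ^ m = (p : ℤ) ^ (m - d) * (p : ℤ) ^ d ∧
      (p : ℤ) ^ n = (p : ℤ) ^ m * (p : ℤ) ^ m := by
  have hp : (1 : ℤ) < p := by exact_mod_cast (Fact.out : p.Prime).one_lt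
  have hd := H.two_dvd_d
  have hd0 := H.d_pos
  have hdm := Nat.le_of_dvd H.m_pos H.d_dvd_m
  refine ⟨one_lt_pow₀ hp (by omega), ?_, by positivity, ?_, ?_⟩
  · rw [← pow_add]; congr 1; omega
  · rw [← pow_add]; congr 1; omega
  · rw [← pow_add, H.n_eq]; congr 1; omega

theorem card_gaussSum (H : Admissible p m n k d F) :
    ((((fixedSet p F m).erase 0).filter
      fun z ↦ gaussSum p d z = ((p ^ d : ℤ) : ℂ)).card : ℤ) = (p : ℤ) ^ (m - d) - 1 ∧
    2 * ((((fixedSet p F m).erase 0).filter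
      fun z ↦ gaussSum p d z = ((p ^ (d / 2) : ℤ) : ℂ)).card : ℤ) =
        (p : ℤ) ^ m - (p : ℤ) ^ (m - d) ∧
    2 * ((((fixedSet p F m).erase 0).filter
      fun z ↦ gaussSum p d z = ((-p ^ (d / 2) : ℤ) : ℂ)).card : ℤ) =
        (p : ℤ) ^ m - (p : ℤ) ^ (m - d) := by
  obtain ⟨hg, hgg, hR, hQ, -⟩ := H.pow_bounds
  have hz0 : gaussSum p d (0 : F) = ((p ^ d : ℤ) : ℂ) := by
    push_cast
    exact H.gaussSum_of_trSum_eq_zero (by simp [trSum_eq])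
  have h0mem : (0 : F) ∈ fixedSet p F m := by simp [mem_fixedSet]
  obtain ⟨hcard, hsum⟩ := sum_eq_sum_mul_card (fixedSet p F m) (gaussSum p d)
    {(p : ℤ) ^ d, (p : ℤ) ^ (d / 2), -(p : ℤ) ^ (d / 2)} (fun z _ ↦ by
      simpa using H.gaussSum_mem z)
  rw [H.sum_gaussSum] at hsum
  have hzero : (p : ℤ) ^ d * (((fixedSet p F m).filter
      fun z ↦ gaussSum p d z = ((p ^ d : ℤ) : ℂ)).card : ℤ) = (p : ℤ) ^ m := by
    have := H.card_trSum_eq_zero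
    rw [Finset.filter_congr (q := fun z ↦ gaussSum p d z = ((p ^ d : ℤ) : ℂ))] at this
    · exact_mod_cast this
    · intro z _
      push_cast
      refine ⟨H.gaussSum_of_trSum_eq_zero, fun h ↦ by_contra fun hz ↦ ?_⟩
      have h2 := H.gaussSum_sq hz
      rw [h] at h2
      have h3 : ((p : ℤ) ^ d) ^ 2 = (p : ℤ) ^ d := by exact_mod_cast h2
      have hD : 1 < (p : ℤ) ^ d := by nlinarith
      nlinarith
  have hD : (p : ℤ) ^ (d / 2) < (p : ℤ) ^ d := by nlinarith
  have herase : ∀ v : ℤ, v ≠ (p : ℤ) ^ d →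
      ((fixedSet p F m).erase 0).filter (fun z ↦ gaussSum p d z = (v : ℂ)) =
        (fixedSet p F m).filter fun z ↦ gaussSum p d z = (v : ℂ) := by
    intro v hv
    rw [Finset.filter_erase, Finset.erase_eq_of_notMem]
    rw [Finset.mem_filter, hz0, Int.cast_inj]
    exact fun h ↦ hv h.2.symm
  have hne2 : -(p : ℤ) ^ (d / 2) ≠ (p : ℤ) ^ d := by linarith
  have hne3 : (p : ℤ) ^ (d / 2) ≠ -(p : ℤ) ^ (d / 2) := by linarith
  have h0 : (0 : F) ∈ (fixedSet p F m).filter fun z ↦ gaussSum p d z = ((p ^ d : ℤ) : ℂ) :=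
    Finset.mem_filter.2 ⟨h0mem, hz0⟩
  rw [herase _ hD.ne, herase _ hne2, Finset.filter_erase,
    Finset.card_erase_of_mem h0, Nat.cast_sub (Finset.card_pos.2 ⟨0, h0⟩), Nat.cast_one]
  rw [card_fixedSet H.card H.m_pos H.m_dvd_n, Nat.cast_pow] at hcard
  rw [Finset.sum_insert (by simp [hD.ne', hne2.symm]), Finset.sum_pair hne3] at hsum hcard
  replace hsum := Int.cast_injective (α := ℂ) (a₁ := (p : ℤ) ^ m)
    (by rw [← hsum, Int.cast_pow, Int.cast_natCast])
  generalize (p : ℤ) ^ d = D at *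
  generalize (p : ℤ) ^ (d / 2) = g at *
  generalize (p : ℤ) ^ (m - d) = R at *
  have hZ := mul_left_cancel₀ (by linarith) (hzero.trans (hQ.trans (mul_comm R D)))
  rw [hZ] at hcard hsum ⊢
  generalize (((fixedSet p F m).filter fun z ↦ gaussSum p d z = (g : ℂ)).card : ℤ) = A at *
  generalize (((fixedSet p F m).filter
    fun z ↦ gaussSum p d z = ((-g : ℤ) : ℂ)).card : ℤ) = B at *
  have hAB : A = B :=
    mul_left_cancel₀ (by linarith : g ≠ 0) (by linear_combination hQ - hsum)
  exact ⟨rfl, by linear_combination hAB - hcard, by linear_combination -hAB - hcard⟩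

end Admissible

omit [Fact p.Prime] [Field F] [Fintype F] [CharP F p] [Algebra (ZMod p) F] in
theorem sum_of_chain {e a y x b q : ℤ} (hea : e < a) (hay : a < y) (hyx : y < x) (hxb : x < b)
    (hbq : b < q) (f : ℤ → ℤ) :
    ∑ v ∈ {q, x, y, a, b, e}, f v = f q + (f x + (f y + (f a + (f b + f e)))) := by
  repeat rw [Finset.sum_insert]
  · rw [Finset.sum_singleton]
  all_goals
    simp only [Finset.mem_insert, Finset.mem_singleton]
    omega

namespace Admissible

theorem card_pairsWith_intCast_mul (H : Admissible p m n k d F) {v : ℤ}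
    (hv : (p : ℤ) ^ n ≠ -(p : ℤ) ^ m * v) {s : ℕ} (hs : v ^ 2 = (p : ℤ) ^ s) :
    ((pairsWith p m k F ((-p ^ m * v : ℤ) : ℂ)).card : ℤ) * ((p : ℤ) ^ s - 1) =
      ((((fixedSet p F m).erase 0).filter fun z ↦ gaussSum p d z = (v : ℂ)).card : ℤ) *
        ((p : ℤ) ^ n - 1) := by
  have h := H.card_pairsWith_mul (w := (v : ℂ)) (by exact_mod_cast hv) (s := s)
    (by exact_mod_cast hs)
  have hp : ∀ j : ℕ, 1 ≤ p ^ j := fun j ↦ Nat.one_le_pow _ _ (Fact.out : p.Prime).pos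
  have hcast : ((-p ^ m * v : ℤ) : ℂ) = -(p : ℂ) ^ m * v := by push_cast; ring
  rw [hcast]
  zify [hp] at h
  exact h

theorem weilSum_mem_int (H : Admissible p m n k d F) {ab : F × F} (hab : ab ∈ pairs p m F) :
    ∃ v ∈ ({(p : ℤ) ^ n, (p : ℤ) ^ m, -(p : ℤ) ^ m * 1, -(p : ℤ) ^ m * p ^ (d / 2),
      -(p : ℤ) ^ m * -p ^ (d / 2), -(p : ℤ) ^ m * p ^ d} : Finset ℤ),
      weilSum p m k ab.1 ab.2 = (v : ℂ) := by
  rcases H.weilSum_mem (mem_fixedSet.2 (mem_pairs.1 hab)) (β := ab.2) with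
    ⟨ha, hb⟩ | (h | h) | ⟨z, h⟩
  · exact ⟨p ^ n, by simp, by rw [ha, hb, H.weilSum_zero]; push_cast; rfl⟩
  · exact ⟨p ^ m, by simp, by rw [h]; push_cast; rfl⟩
  · exact ⟨-p ^ m * 1, by simp, by rw [h]; push_cast; ring⟩
  · have hz := H.gaussSum_mem z
    rcases hz with hz | hz | hz <;> rw [hz] at h
    · exact ⟨-p ^ m * p ^ d, by simp, by rw [h]; push_cast; ring⟩
    · exact ⟨-p ^ m * p ^ (d / 2), by simp, by rw [h]; push_cast; ring⟩
    · exact ⟨-p ^ m * -p ^ (d / 2), by simp, by rw [h]; push_cast; ring⟩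

theorem pairsWith_card_field (H : Admissible p m n k d F) :
    pairsWith p m k F ((p ^ n : ℤ) : ℂ) = {(0, 0)} := by
  obtain ⟨hg, hgg, hR, hQ, hq⟩ := H.pow_bounds
  have hgD : (p : ℤ) ^ (d / 2) < (p : ℤ) ^ d := by nlinarith
  have hDQ : (p : ℤ) ^ d ≤ (p : ℤ) ^ m := by nlinarith
  have hgQ : (p : ℤ) ^ m * (p : ℤ) ^ (d / 2) < (p : ℤ) ^ m * (p : ℤ) ^ m := by nlinarith
  ext ⟨α, β⟩
  rw [pairsWith, Finset.mem_filter, Finset.mem_singleton, Prod.mk_inj]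
  constructor
  · rintro ⟨hα, h⟩
    have hα := mem_fixedSet.2 (mem_pairs.1 hα)
    rcases H.weilSum_mem hα (β := β) with h0 | (h' | h') | ⟨z, h'⟩
    · exact h0
    · have h1 : (p : ℤ) ^ n = (p : ℤ) ^ m := by exact_mod_cast h.symm.trans h'
      nlinarith
    · have h1 : (p : ℤ) ^ n = -(p : ℤ) ^ m := by exact_mod_cast h.symm.trans h'
      nlinarith
    · rw [h] at h'
      have hz := H.gaussSum_mem z
      rcases hz with hz | hz | hz <;> rw [hz] at h'
      · have h1 : (p : ℤ) ^ n = -(p : ℤ) ^ m * (p : ℤ) ^ d := by exact_mod_cast h'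
        nlinarith
      · have h1 : (p : ℤ) ^ n = -(p : ℤ) ^ m * (p : ℤ) ^ (d / 2) := by exact_mod_cast h'
        nlinarith
      · have h1 : (p : ℤ) ^ n = -(p : ℤ) ^ m * -(p : ℤ) ^ (d / 2) := by exact_mod_cast h'
        nlinarith
  · rintro ⟨rfl, rfl⟩
    exact ⟨mem_pairs.2 (map_zero _), by rw [H.weilSum_zero]; push_cast; rfl⟩

theorem card_pairsWith (H : Admissible p m n k d F) :
    2 * ((pairsWith p m k F ((-p ^ m * -p ^ (d / 2) : ℤ) : ℂ)).card : ℤ) =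
        (p : ℤ) ^ (m - d) * ((p : ℤ) ^ n - 1) ∧
    2 * ((p : ℤ) ^ d + 1) * ((pairsWith p m k F ((p ^ m : ℤ) : ℂ)).card : ℤ) =
        (p : ℤ) ^ d * ((p : ℤ) ^ m - 1) * ((p : ℤ) ^ m + 1) ^ 2 ∧
    2 * ((p : ℤ) ^ d - 1) * ((pairsWith p m k F ((-p ^ m * 1 : ℤ) : ℂ)).card : ℤ) =
        (p : ℤ) ^ d * ((p : ℤ) ^ m - 1) * ((p : ℤ) ^ n - 2 * (p : ℤ) ^ (n - d) + 1) ∧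
    2 * ((pairsWith p m k F ((-p ^ m * p ^ (d / 2) : ℤ) : ℂ)).card : ℤ) =
        (p : ℤ) ^ (m - d) * ((p : ℤ) ^ n - 1) ∧
    ((p : ℤ) ^ (2 * d) - 1) * ((pairsWith p m k F ((-p ^ m * p ^ d : ℤ) : ℂ)).card : ℤ) =
        ((p : ℤ) ^ (m - d) - 1) * ((p : ℤ) ^ n - 1) := by
  obtain ⟨hg, hgg, hR, hQ, hq⟩ := H.pow_bounds
  obtain ⟨hZ, hA, hB⟩ := H.card_gaussSum
  have hdm := Nat.le_of_dvd H.m_pos H.d_dvd_m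
  have hQR : (p : ℤ) ^ (n - d) = (p : ℤ) ^ (m - d) * (p : ℤ) ^ m := by
    rw [← pow_add, H.n_eq]; congr 1; omega
  have hD : (p : ℤ) ^ (d / 2) < (p : ℤ) ^ d := by nlinarith
  have hDQ : (p : ℤ) ^ d ≤ (p : ℤ) ^ m := by nlinarith
  have hgQ : (p : ℤ) ^ (d / 2) < (p : ℤ) ^ m := by linarith
  have eA := H.card_pairsWith_intCast_mul (v := p ^ (d / 2)) (s := d) (by nlinarith) (by
    rw [hgg]; ring)
  have eB := H.card_pairsWith_intCast_mul (v := -p ^ (d / 2)) (s := d) (by nlinarith) (by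
    rw [hgg]; ring)
  have eE := H.card_pairsWith_intCast_mul (v := p ^ d) (s := 2 * d) (by nlinarith) (by
    rw [mul_comm, pow_mul])
  obtain ⟨hcard, hsum⟩ := sum_eq_sum_mul_card (pairs p m F)
    (fun ab ↦ weilSum p m k ab.1 ab.2) _ fun ab hab ↦ H.weilSum_mem_int hab
  rw [H.sum_weilSum] at hsum
  have hpairs : ((pairs p m F).card : ℤ) = (p : ℤ) ^ m * (p : ℤ) ^ n := by
    rw [pairs, Finset.card_product, card_fixedSet H.card H.m_pos H.m_dvd_n, Finset.card_univ,
      H.card]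
    push_cast; rfl
  replace hsum := Int.cast_injective (α := ℂ) (a₁ := (p : ℤ) ^ m * (p : ℤ) ^ n)
    (by rw [← hsum]; push_cast; rfl)
  rw [hpairs] at hcard
  have h0 := H.pairsWith_card_field
  simp only [pairsWith] at *
  have h2d : (p : ℤ) ^ (2 * d) = (p : ℤ) ^ d * (p : ℤ) ^ d := by rw [two_mul, pow_add]
  rw [h2d] at eE ⊢
  generalize (p : ℤ) ^ d = D at *
  generalize (p : ℤ) ^ (d / 2) = g at *
  generalize (p : ℤ) ^ (m - d) = R at *
  generalize (p : ℤ) ^ m = Q at *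
  generalize (p : ℤ) ^ n = q at *
  have hQgD : Q * g < Q * D := by nlinarith
  have hQg : Q < Q * g := by nlinarith
  have hQq : Q * g < q := by nlinarith
  have hsplit := sum_of_chain (e := -Q * D) (a := -Q * g) (y := -Q * 1) (x := Q) (b := -Q * -g)
    (q := q) (by linarith) (by linarith) (by linarith) (by linarith) (by linarith)
  rw [hsplit, h0] at hcard hsum
  rw [Finset.card_singleton, Nat.cast_one] at hcard hsum
  generalize ((Finset.filter (fun i : F × F ↦ weilSum p m k i.1 i.2 = (Q : ℂ))
    (pairs p m F)).card : ℤ) = X at *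
  generalize ((Finset.filter (fun i : F × F ↦ weilSum p m k i.1 i.2 = ((-Q * 1 : ℤ) : ℂ))
    (pairs p m F)).card : ℤ) = Y at *
  generalize ((Finset.filter (fun i : F × F ↦ weilSum p m k i.1 i.2 = ((-Q * g : ℤ) : ℂ))
    (pairs p m F)).card : ℤ) = A at *
  generalize ((Finset.filter (fun i : F × F ↦ weilSum p m k i.1 i.2 = ((-Q * -g : ℤ) : ℂ))
    (pairs p m F)).card : ℤ) = B at *
  generalize ((Finset.filter (fun i : F × F ↦ weilSum p m k i.1 i.2 = ((-Q * D : ℤ) : ℂ))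
    (pairs p m F)).card : ℤ) = E at *
  rw [hZ] at eE
  have hD1 : D - 1 ≠ 0 := by linarith
  have hA' : 2 * A = R * (q - 1) := mul_left_cancel₀ hD1 (by
    linear_combination 2 * eA + (q - 1) * hA + (q - 1) * hQ)
  have hB' : 2 * B = R * (q - 1) := mul_left_cancel₀ hD1 (by
    linear_combination 2 * eB + (q - 1) * hB + (q - 1) * hQ)
  rw [hQR]
  have hAB : A + B = R * (q - 1) := by linarith
  have hBA : B = A := by linarith
  have hsum' : Q * Q = Q + X - Y - D * E := mul_left_cancel₀ (by linarith : Q ≠ 0) (by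
    linear_combination hsum + (1 - Q) * hq + Q * g * hBA)
  refine ⟨hB', ?_, ?_, hA', by linear_combination eE⟩
  · linear_combination (-(D + 1)) * (hcard + hsum' + hAB) + eE + (q - 1) * hQ + (D * Q - 1) * hq
  · linear_combination (-(D - 1)) * (hcard - hsum' + hAB) - eE + (q - 1 - 2 * (Q ^ 2 - Q)) * hQ +
      (D + 1 - 2 * Q) * hq

end Admissible

omit [Fact p.Prime] [CharP F p] [Algebra (ZMod p) F] in
theorem card_exponents_of_forall_eq_pow {π : F} (hπ0 : π ≠ 0)
    (hπ : ∀ x : F, x ≠ 0 → ∃ i : ℕ, π ^ i = x) {P : F → Prop} [DecidablePred P] (hP : ¬P 0) :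
    Nat.card {i : ℕ // i ≤ Fintype.card F - 2 ∧ P (π ^ i)} = (Finset.univ.filter P).card := by
  have hq := Fintype.one_lt_card (α := F)
  have himage : (Finset.range (Fintype.card F - 1)).image (π ^ ·) = Finset.univ.erase 0 := by
    ext x
    simp only [Finset.mem_image, Finset.mem_range, Finset.mem_erase, Finset.mem_univ, and_true]
    constructor
    · rintro ⟨i, -, rfl⟩
      exact pow_ne_zero _ hπ0
    · intro hx
      obtain ⟨i, rfl⟩ := hπ x hx
      exact ⟨i % (Fintype.card F - 1), Nat.mod_lt _ (by omega),
        (pow_eq_pow_mod i (FiniteField.pow_card_sub_one_eq_one π hπ0)).symm⟩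
  have hinj : Set.InjOn (π ^ ·) (Finset.range (Fintype.card F - 1) : Set ℕ) := by
    rw [← Finset.card_image_iff, himage, Finset.card_erase_of_mem (Finset.mem_univ _),
      Finset.card_univ, Finset.card_range]
  have hfilter : Finset.univ.filter P =
      ((Finset.range (Fintype.card F - 1)).filter fun i ↦ P (π ^ i)).image (π ^ ·) := by
    rw [← Finset.filter_image (p := P), himage, Finset.filter_erase,
      Finset.erase_eq_of_notMem (by simp [hP])]
  rw [hfilter, Finset.card_image_of_injOn
    (hinj.mono (Finset.coe_subset.2 (Finset.filter_subset _ _))),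
    Nat.subtype_card ((Finset.range (Fintype.card F - 1)).filter fun i ↦ P (π ^ i))]
  intro i
  rw [Finset.mem_filter, Finset.mem_range]
  exact and_congr_left fun _ ↦ by omega

namespace Admissible

omit [Algebra (ZMod p) F] in
theorem trSum_half (H : Admissible p m n k d F) {t : ℕ} (ht : t ∣ m) {c : F}
    (hc : c ∈ fixedSet p F m) : trSum p t (n / t) (2⁻¹ * c) = trSum p t (m / t) c := by
  have hc' : 2⁻¹ * c ∈ fixedSet p F m := by
    rw [mem_fixedSet] at *
    rw [map_mul, hc, map_inv₀, map_ofNat]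
  have hnt : n / t = m / t * (n / m) := by
    rw [Nat.div_mul_div_comm ht H.m_dvd_n, mul_comm t, Nat.mul_div_mul_left _ _ H.m_pos]
  rw [hnt, ← trSum_trSum, Nat.mul_div_cancel' ht,
    H.trSum_of_mem_fixedSet hc', mul_inv_cancel_left₀ H.two_ne_zero]

theorem mul_card_trSum_form_eq_zero (H : Admissible p m n k d F) {t : ℕ} (ht0 : 0 < t)
    (h2t : 2 * t ∣ d) (α β : F) :
    (p : ℂ) ^ t * ((Finset.univ.filter
      fun x ↦ trSum p t (n / t) (form p m k α β x) = 0).card : ℂ) =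
      (p : ℂ) ^ n + ((p : ℂ) ^ t - 1) * weilSum p m k α β := by
  have htn : t ∣ n := ((dvd_mul_left t 2).trans h2t).trans H.d_dvd_n
  have hp : 1 ≤ p ^ t := Nat.one_le_pow _ _ (Fact.out : p.Prime).pos
  have h0 : (0 : F) ∈ fixedSet p F t := by simp [mem_fixedSet]
  calc _ = ∑ x, ∑ c ∈ fixedSet p F t, ψ (c * form p m k α β x) := by
        simp only [sum_fixedSet_canonicalChar H.card ht0 htn]
        rw [← Finset.sum_filter, Finset.sum_const, nsmul_eq_mul, mul_comm]
    _ = ∑ c ∈ fixedSet p F t, weilSum p m k (c * α) (c * β) := by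
        rw [Finset.sum_comm]
        refine Finset.sum_congr rfl fun c _ ↦ Finset.sum_congr rfl fun x _ ↦ ?_
        congr 1
        simp only [form]
        ring
    _ = _ := by
        rw [← Finset.add_sum_erase _ _ h0, zero_mul, zero_mul, H.weilSum_zero,
          Finset.sum_congr rfl (g := fun _ ↦ weilSum p m k α β), Finset.sum_const,
          Finset.card_erase_of_mem h0, card_fixedSet H.card ht0 htn, nsmul_eq_mul]
        · push_cast [hp]; rfl
        intro c hc
        obtain ⟨hc0, hc⟩ := Finset.mem_erase.1 hc
        obtain ⟨e, he, he0, rfl⟩ := H.exists_sq_eq h2t hc hc0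
        exact H.weilSum_mul_sq he he0 α β

theorem mul_wt1 (H : Admissible p m n k d F) {t : ℕ} (ht0 : 0 < t) (h2t : 2 * t ∣ d) {π : F}
    (hπ : ∀ x : F, x ≠ 0 → ∃ i : ℕ, π ^ i = x) {α : F} (hα : α ∈ fixedSet p F m) (β : F) :
    (p : ℂ) ^ t * (wt1 p m n k t π α β : ℂ) =
      ((p : ℂ) ^ t - 1) * ((p : ℂ) ^ n - weilSum p m k α β) := by
  have htm : t ∣ m := ((dvd_mul_left t 2).trans h2t).trans H.d_dvd_m
  have hπ0 : π ≠ 0 := by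
    rintro rfl
    obtain ⟨i, hi⟩ := hπ (-1) (neg_ne_zero.2 one_ne_zero)
    rcases eq_or_ne i 0 with rfl | hi0
    · exact H.two_ne_zero (by linear_combination hi)
    · simp [hi0] at hi
  have hform : ∀ x, trSum p t (m / t) (α * x ^ (p ^ m + 1)) +
      trSum p t (n / t) (β * x ^ (p ^ k + 1)) = trSum p t (n / t) (form p m k α β x) := by
    intro x
    have hmem : α * (frob p m x * x) ∈ fixedSet p F m := by
      rw [mem_fixedSet, map_mul, mem_fixedSet.1 hα, mem_fixedSet.1 (H.norm_mem_fixedSet x)]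
    rw [form, trSum_add, mul_assoc, H.trSum_half htm hmem]
    simp only [frob_apply, pow_succ]
  have hwt : wt1 p m n k t π α β =
      (Finset.univ.filter fun x ↦ ¬trSum p t (n / t) (form p m k α β x) = 0).card := by
    rw [← card_exponents_of_forall_eq_pow (P := fun x ↦ ¬trSum p t (n / t) (form p m k α β x) = 0)
      hπ0 hπ (by simp [form, trSum_eq]), wt1, H.card]
    simp only [pow_mul, hform, ne_eq]
  have hadd := Finset.card_filter_add_card_filter_not (s := (Finset.univ : Finset F))
    fun x ↦ trSum p t (n / t) (form p m k α β x) = 0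
  rw [← hwt, Finset.card_univ, H.card] at hadd
  have hzero := H.mul_card_trSum_form_eq_zero ht0 h2t α β
  have hadd' := congrArg (Nat.cast (R := ℂ)) hadd
  push_cast at hadd'
  linear_combination (p : ℂ) ^ t * hadd' - hzero

end Admissible

namespace Admissible

theorem wt1_eq_iff (H : Admissible p m n k d F) {t : ℕ} (ht0 : 0 < t) (h2t : 2 * t ∣ d) {π : F}
    (hπ : ∀ x : F, x ≠ 0 → ∃ i : ℕ, π ^ i = x) {w : ℕ} {v : ℤ}
    (hwv : (p : ℤ) ^ t * w = ((p : ℤ) ^ t - 1) * ((p : ℤ) ^ n - v)) {α : F}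
    (hα : α ∈ fixedSet p F m) (β : F) :
    wt1 p m n k t π α β = w ↔ weilSum p m k α β = (v : ℂ) := by
  have h := H.mul_wt1 ht0 h2t hπ hα β
  have hwv' : (p : ℂ) ^ t * w = ((p : ℂ) ^ t - 1) * ((p : ℂ) ^ n - v) := by exact_mod_cast hwv
  have hpt : 1 < p ^ t := Nat.one_lt_pow ht0.ne' (Fact.out : p.Prime).one_lt
  have h0 : (p : ℂ) ^ t ≠ 0 := by exact_mod_cast (by omega : p ^ t ≠ 0)
  have h1 : (p : ℂ) ^ t - 1 ≠ 0 := sub_ne_zero.2 (by exact_mod_cast hpt.ne')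
  constructor
  · rintro rfl
    have := mul_left_cancel₀ h1 (h.symm.trans hwv')
    linear_combination -this
  · intro hv
    rw [hv, ← hwv'] at h
    exact_mod_cast mul_left_cancel₀ h0 h

theorem wt1count_eq (H : Admissible p m n k d F) {t : ℕ} (ht0 : 0 < t) (h2t : 2 * t ∣ d) {π : F}
    (hπ : ∀ x : F, x ≠ 0 → ∃ i : ℕ, π ^ i = x) {w : ℕ} {v : ℤ}
    (hwv : (p : ℤ) ^ t * w = ((p : ℤ) ^ t - 1) * ((p : ℤ) ^ n - v)) :
    wt1count p m n k t F π w = (pairsWith p m k F (v : ℂ)).card := by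
  rw [wt1count, Nat.subtype_card]
  intro ab
  rw [pairsWith, Finset.mem_filter, mem_pairs, ← frob_apply]
  exact and_congr_right fun h ↦ (H.wt1_eq_iff ht0 h2t hπ hwv (mem_fixedSet.2 h) _).symm

end Admissible

omit [Field F] [Fintype F] [CharP F p] [Algebra (ZMod p) F] in
theorem mul_weight_sub {t a b : ℕ} (htb : t ≤ b) (hba : b ≤ a) {v : ℤ} (hv : v = (p : ℤ) ^ b) :
    (p : ℤ) ^ t * ((p ^ t - 1) * (p ^ (a - t) - p ^ (b - t)) : ℕ) =
      ((p : ℤ) ^ t - 1) * ((p : ℤ) ^ a - v) := by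
  subst hv
  have hp := (Fact.out : p.Prime).pos
  rw [Nat.cast_mul, Nat.cast_sub (Nat.one_le_pow _ _ hp),
    Nat.cast_sub (Nat.pow_le_pow_right hp (by omega))]
  obtain ⟨b, rfl⟩ := Nat.exists_eq_add_of_le htb
  obtain ⟨a, rfl⟩ := Nat.exists_eq_add_of_le (htb.trans hba)
  push_cast [Nat.add_sub_cancel_left]
  ring

omit [Field F] [Fintype F] [CharP F p] [Algebra (ZMod p) F] in
theorem mul_weight_add {t a b : ℕ} (htb : t ≤ b) (hta : t ≤ a) {v : ℤ} (hv : v = -(p : ℤ) ^ b) :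
    (p : ℤ) ^ t * ((p ^ t - 1) * (p ^ (a - t) + p ^ (b - t)) : ℕ) =
      ((p : ℤ) ^ t - 1) * ((p : ℤ) ^ a - v) := by
  subst hv
  rw [Nat.cast_mul, Nat.cast_sub (Nat.one_le_pow _ _ (Fact.out : p.Prime).pos)]
  obtain ⟨b, rfl⟩ := Nat.exists_eq_add_of_le htb
  obtain ⟨a, rfl⟩ := Nat.exists_eq_add_of_le hta
  push_cast [Nat.add_sub_cancel_left]
  ring

end WeilSum

theorem admissible_of_gcd {p m n k d : ℕ} [Fact p.Prime] {F : Type} [Field F] [Fintype F]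
    [CharP F p] (hodd : p % 2 = 1) (hF : Fintype.card F = p ^ n) (hn : n = 2 * m) (hk : k ≤ n)
    (hd : d = m.gcd k) (hd' : (m + k).gcd (2 * k) = d) (h2 : 2 ∣ d) :
    Admissible p m n k d F where
  ne_two := by rintro rfl; omega
  card := hF
  n_eq := hn
  k_le := hk
  d_dvd_m := hd ▸ Nat.gcd_dvd_left m k
  d_dvd_k := hd ▸ Nat.gcd_dvd_right m k
  two_dvd_d := h2
  fixed_of_frob_eq x hx := by
    have hfix : frob p (m + k) x = x := by
      rw [← frob_frob, hx, frob_frob, ← two_mul, ← hn, frob_card hF]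
    have hgcd : (m + k).gcd n ∣ d := by
      rw [← hd', hn]
      refine Nat.dvd_gcd (Nat.gcd_dvd_left _ _) ?_
      have h : 2 * (m + k) - 2 * m = 2 * k := by omega
      exact h ▸ Nat.dvd_sub ((Nat.gcd_dvd_left _ _).mul_left 2) (Nat.gcd_dvd_right _ _)
    exact frob_of_dvd hgcd (frob_gcd hfix (frob_card hF x))

end CyclicWeight

theorem stmt12 (p m k n d d' : ℕ) (hp : Nat.Prime p) (hodd : p % 2 = 1)
    (hm : 0 < m) (hn : n = 2 * m) (hk : k ≤ n - 1) (hkm : k ≠ m)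
    (hd : d = Nat.gcd m k) (hd' : d' = Nat.gcd (m + k) (2 * k))
    (F : Type) [Field F] [Fintype F] [Algebra (ZMod p) F] (hF : Fintype.card F = p ^ n) (t : ℕ) (ht0 : 0 < t) (ht : t ∣ d)
    (π : F) (hπ : ∀ x : F, x ≠ 0 → ∃ i : ℕ, π ^ i = x)
    (hcase : d' = d) (hdt : (d / t) % 2 = 0) :
    (2 * (wt1count p m n k t F π ((p ^ t - 1) * (p ^ (n - t) - p ^ (m + d / 2 - t))) : ℤ)
        = (p : ℤ) ^ (m - d) * ((p : ℤ) ^ n - 1)) ∧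
    (2 * ((p : ℤ) ^ d + 1) *
        (wt1count p m n k t F π ((p ^ t - 1) * (p ^ (n - t) - p ^ (m - t))) : ℤ)
        = (p : ℤ) ^ d * ((p : ℤ) ^ m - 1) * ((p : ℤ) ^ m + 1) ^ 2) ∧
    (2 * ((p : ℤ) ^ d - 1) *
        (wt1count p m n k t F π ((p ^ t - 1) * (p ^ (n - t) + p ^ (m - t))) : ℤ)
        = (p : ℤ) ^ d * ((p : ℤ) ^ m - 1) * ((p : ℤ) ^ n - 2 * (p : ℤ) ^ (n - d) + 1)) ∧
    (2 * (wt1count p m n k t F π ((p ^ t - 1) * (p ^ (n - t) + p ^ (m + d / 2 - t))) : ℤ)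
        = (p : ℤ) ^ (m - d) * ((p : ℤ) ^ n - 1)) ∧
    (((p : ℤ) ^ (2 * d) - 1) *
        (wt1count p m n k t F π ((p ^ t - 1) * (p ^ (n - t) + p ^ (m + d - t))) : ℤ)
        = ((p : ℤ) ^ (m - d) - 1) * ((p : ℤ) ^ n - 1)) ∧
    (wt1count p m n k t F π 0 = 1) ∧
    (∀ α β : F, α ^ p ^ m = α →
      wt1 p m n k t π α β = (p ^ t - 1) * (p ^ (n - t) - p ^ (m + d / 2 - t)) ∨
      wt1 p m n k t π α β = (p ^ t - 1) * (p ^ (n - t) - p ^ (m - t)) ∨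
      wt1 p m n k t π α β = (p ^ t - 1) * (p ^ (n - t) + p ^ (m - t)) ∨
      wt1 p m n k t π α β = (p ^ t - 1) * (p ^ (n - t) + p ^ (m + d / 2 - t)) ∨
      wt1 p m n k t π α β = (p ^ t - 1) * (p ^ (n - t) + p ^ (m + d - t)) ∨
      wt1 p m n k t π α β = 0) := by
  have : Fact p.Prime := ⟨hp⟩
  have : CharP F p := charP_of_injective_algebraMap (algebraMap (ZMod p) F).injective p
  have h2t : 2 * t ∣ d := by
    obtain ⟨e, rfl⟩ := ht
    rw [Nat.mul_div_cancel_left _ ht0] at hdt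
    rw [mul_comm]
    exact Nat.mul_dvd_mul_left t (Nat.dvd_of_mod_eq_zero hdt)
  have H : CyclicWeight.Admissible p m n k d F :=
    CyclicWeight.admissible_of_gcd hodd hF hn (by omega) hd (hd' ▸ hcase)
      ((dvd_mul_right 2 t).trans h2t)
  have htd : 2 * t ≤ d := Nat.le_of_dvd H.d_pos h2t
  have hdm : d ≤ m := Nat.le_of_dvd hm H.d_dvd_m
  have w₁ := CyclicWeight.mul_weight_sub (p := p) (t := t) (a := n) (b := m + d / 2)
    (v := -p ^ m * -p ^ (d / 2)) (by omega) (by omega) (by ring)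
  have w₂ := CyclicWeight.mul_weight_sub (p := p) (t := t) (a := n) (b := m)
    (v := p ^ m) (by omega) (by omega) rfl
  have w₃ := CyclicWeight.mul_weight_add (p := p) (t := t) (a := n) (b := m)
    (v := -p ^ m * 1) (by omega) (by omega) (by ring)
  have w₄ := CyclicWeight.mul_weight_add (p := p) (t := t) (a := n) (b := m + d / 2)
    (v := -p ^ m * p ^ (d / 2)) (by omega) (by omega) (by ring)
  have w₅ := CyclicWeight.mul_weight_add (p := p) (t := t) (a := n) (b := m + d)
    (v := -p ^ m * p ^ d) (by omega) (by omega) (by ring)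
  have w₆ : (p : ℤ) ^ t * (0 : ℕ) = ((p : ℤ) ^ t - 1) * ((p : ℤ) ^ n - (p : ℤ) ^ n) := by simp
  obtain ⟨c₁, c₂, c₃, c₄, c₅⟩ := H.card_pairsWith
  refine ⟨?_, ?_, ?_, ?_, ?_, ?_, fun α β hα ↦ ?_⟩
  · rw [H.wt1count_eq ht0 h2t hπ w₁, c₁]
  · rw [H.wt1count_eq ht0 h2t hπ w₂, c₂]
  · rw [H.wt1count_eq ht0 h2t hπ w₃, c₃]
  · rw [H.wt1count_eq ht0 h2t hπ w₄, c₄]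
  · rw [H.wt1count_eq ht0 h2t hπ w₅, c₅]
  · rw [H.wt1count_eq ht0 h2t hπ w₆, H.pairsWith_card_field, Finset.card_singleton]
  · rw [← CyclicWeight.frob_apply] at hα
    obtain ⟨v, hv, hvw⟩ := H.weilSum_mem_int (CyclicWeight.Admissible.mem_pairs (ab := (α, β)).2 hα)
    replace hα := CyclicWeight.mem_fixedSet.2 hα
    rw [H.wt1_eq_iff ht0 h2t hπ w₁ hα, H.wt1_eq_iff ht0 h2t hπ w₂ hα,
      H.wt1_eq_iff ht0 h2t hπ w₃ hα, H.wt1_eq_iff ht0 h2t hπ w₄ hα,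
      H.wt1_eq_iff ht0 h2t hπ w₅ hα, H.wt1_eq_iff ht0 h2t hπ w₆ hα]
    simp only [hvw, Int.cast_inj]
    simp only [Finset.mem_insert, Finset.mem_singleton] at hv
    tauto
end
end

section
/- Suppose d' = 2d and t is a positive divisor of d. Then, as (α,β) ranges over F_{p^m} × F_q, the codeword weight w(α,β) equals: (p^t−1)(p^{n−t}−p^{m+d−t}) for exactly p^d(p^n−1)(p^m+p^{m−d}+p^{m−2d}+1)/(p^d+1)^2 pairs; (p^t−1)(p^{n−t}+p^{m−t}) for exactly p^{3d}(p^m−1)(p^n−p^{n−2d}−p^{n−3d}+p^m−p^{m−d}+1)/((p^d+1)(p^{2d}−1)) pairs; (p^t−1)(p^{n−t}+p^{m+2d−t}) for exactly (p^{m−d}−1)(p^n−1)/((p^d+1)(p^{2d}−1)) pairs; and 0 for exactly 1 pair (namely (0,0)); w takes no other values. -/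
open scoped BigOperators Classical

noncomputable section

section FrobeniusPowers

variable {F : Type} [Field F] {p : ℕ}

lemma isPeriodicPt_pow_iff {a : ℕ} {x : F} :
    Function.IsPeriodicPt (fun y : F => y ^ p) a x ↔ x ^ p ^ a = x := by
  rw [Function.IsPeriodicPt, Function.IsFixedPt, pow_iterate]

lemma pow_pow_eq_self_gcd {a b : ℕ} {x : F} (ha : x ^ p ^ a = x) (hb : x ^ p ^ b = x) :
    x ^ p ^ Nat.gcd a b = x :=
  isPeriodicPt_pow_iff.1 ((isPeriodicPt_pow_iff.2 ha).gcd (isPeriodicPt_pow_iff.2 hb))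

lemma pow_pow_eq_self_of_dvd {a b : ℕ} {x : F} (ha : x ^ p ^ a = x) (hab : a ∣ b) :
    x ^ p ^ b = x :=
  isPeriodicPt_pow_iff.1 ((isPeriodicPt_pow_iff.2 ha).trans_dvd hab)

/-- On the fixed points of the `2d`-th power of Frobenius, an odd multiple of `d` acts as `d`. -/
lemma pow_pow_odd_mul {d s : ℕ} {x : F} (hx : x ^ p ^ (2 * d) = x) (hs : Odd s) :
    x ^ p ^ (d * s) = x ^ p ^ d := by
  obtain ⟨i, rfl⟩ := hs
  rw [show d * (2 * i + 1) = 2 * d * i + d by ring, pow_add, pow_mul,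
    pow_pow_eq_self_of_dvd hx (dvd_mul_right (2 * d) i)]

variable [Fintype F]

lemma card_filter_pow_eq_one {j : ℕ} (hj : j ∣ Fintype.card F - 1) (hj0 : 0 < j) :
    (Finset.univ.filter fun x : F => x ^ j = 1).card = j := by
  have hc : Nat.card Fˣ = Fintype.card F - 1 := by
    rw [Nat.card_eq_fintype_card, Fintype.card_units]
  have h := IsCyclic.card_powMonoidHom_ker Fˣ j
  rw [hc, Nat.gcd_eq_right hj] at h
  refine Eq.trans ?_ h
  rw [← SetLike.coe_sort_coe, Nat.card_coe_set_eq, ← Set.ncard_coe_finset,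
    ← Set.ncard_image_of_injective _ Units.val_injective]
  congr 1
  ext x
  simp only [Finset.coe_filter, Finset.mem_univ, true_and, Set.mem_ofPred_eq, Set.mem_image,
    SetLike.mem_coe, MonoidHom.mem_ker, powMonoidHom_apply]
  constructor
  · intro hx
    exact ⟨Units.ofPowEqOne x j hx hj0.ne', Units.pow_ofPowEqOne hx hj0.ne', rfl⟩
  · rintro ⟨u, hu, rfl⟩
    rw [← Units.val_pow_eq_pow_val, hu, Units.val_one]

/-- The elements of the subfield of size `p ^ t`. -/
def frobFixed (F : Type) [Field F] [Fintype F] (p t : ℕ) : Finset F :=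
  Finset.univ.filter fun x : F => x ^ p ^ t = x

lemma mem_frobFixed {t : ℕ} {x : F} : x ∈ frobFixed F p t ↔ x ^ p ^ t = x := by
  simp [frobFixed]

variable [hp : Fact p.Prime]

lemma card_frobFixed {n t : ℕ} (hF : Fintype.card F = p ^ n) (ht0 : 0 < t) (ht : t ∣ n) :
    (frobFixed F p t).card = p ^ t := by
  have h1 : 1 < p ^ t := Nat.one_lt_pow ht0.ne' hp.out.one_lt
  have hd : p ^ t - 1 ∣ Fintype.card F - 1 := by
    rw [hF]
    obtain ⟨r, rfl⟩ := ht
    rw [pow_mul]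
    simpa using Nat.sub_dvd_pow_sub_pow (p ^ t) 1 r
  have h : frobFixed F p t =
      insert 0 (Finset.univ.filter fun x : F => x ^ (p ^ t - 1) = 1) := by
    ext x
    simp only [mem_frobFixed, Finset.mem_insert, Finset.mem_filter, Finset.mem_univ, true_and]
    rcases eq_or_ne x 0 with rfl | hx
    · simp [hp.out.ne_zero]
    · simp only [hx, false_or]
      conv_lhs => rw [← Nat.sub_add_cancel h1.le, pow_succ]
      exact mul_eq_right₀ hx
  rw [h, Finset.card_insert_of_notMem, card_filter_pow_eq_one hd (by omega)]
  · omega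
  · simp [zero_pow (Nat.sub_pos_of_lt h1).ne']

end FrobeniusPowers

section TraceSums

variable {F : Type} [Field F] {p : ℕ}

lemma trSum_mul_of_fixed {t r : ℕ} {a y : F} (ha : a ^ p ^ t = a) :
    trSum p t r (a * y) = a * trSum p t r y := by
  simp only [trSum, Finset.mul_sum, mul_pow]
  exact Finset.sum_congr rfl fun i _ => by
    rw [pow_pow_eq_self_of_dvd ha (dvd_mul_right t i)]

variable [hp : Fact p.Prime] [CharP F p]

lemma trSum_add (t r : ℕ) (x y : F) : trSum p t r (x + y) = trSum p t r x + trSum p t r y := by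
  simp only [trSum, add_pow_char_pow, Finset.sum_add_distrib]

lemma trSum_pow_char_pow (t r : ℕ) (x : F) : trSum p t r x ^ p ^ t = trSum p t r (x ^ p ^ t) := by
  simp only [trSum, sum_pow_char_pow, ← pow_mul]
  exact Finset.sum_congr rfl fun i _ => by rw [mul_comm]

lemma trSum_fixed {t r : ℕ} {x : F} (hx : x ^ p ^ (t * r) = x) :
    trSum p t r x ^ p ^ t = trSum p t r x := by
  rw [trSum_pow_char_pow]
  have h := Finset.sum_range_succ' (fun i => x ^ p ^ (t * i)) r
  rw [Finset.sum_range_succ, hx] at h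
  simp only [mul_zero, pow_zero, pow_one] at h
  simp only [trSum, ← pow_mul, ← pow_add]
  rw [add_right_cancel h]
  exact Finset.sum_congr rfl fun i _ => by rw [mul_add, mul_one, add_comm]

lemma trSum_trSum (t r : ℕ) (x : F) : trSum p 1 t (trSum p t r x) = trSum p 1 (t * r) x := by
  induction r with
  | zero => simp [trSum, hp.out.ne_zero]
  | succ r ih =>
    have h : trSum p t (r + 1) x = trSum p t r x + x ^ p ^ (t * r) := by
      simp [trSum, Finset.sum_range_succ]
    rw [h, trSum_add, ih, mul_add, mul_one]
    simp only [trSum, one_mul, Finset.sum_range_add, ← pow_mul, ← pow_add]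

/-- The trace of half an element of the intermediate field. -/
lemma trSum_two_mul_half {t r : ℕ} (h2 : (2 : F) ≠ 0) {u : F} (hu : u ^ p ^ (t * r) = u) :
    trSum p t (2 * r) (u / 2) = trSum p t r u := by
  have hs : trSum p t (2 * r) u = trSum p t r u + trSum p t r u := by
    simp only [trSum, two_mul r, Finset.sum_range_add]
    congr 1
    exact Finset.sum_congr rfl fun i _ => by rw [mul_add, pow_add, pow_mul, hu]
  have : NeZero (2 : F) := ⟨h2⟩
  have h := trSum_add (p := p) t (2 * r) (u / 2) (u / 2)
  rw [add_halves, hs, ← two_mul, ← two_mul] at h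
  exact (mul_left_cancel₀ h2 h).symm

end TraceSums

/-- A nontrivial additive character factoring through the absolute trace. -/
structure IsTraceChar (p n : ℕ) {F : Type} [Field F] (ψ : AddChar F ℂ) : Prop where
  ne_one : ψ ≠ 1
  eq_one_of_trSum : ∀ y : F, trSum p 1 n y = 0 → ψ y = 1

lemma exists_isTraceChar (p n : ℕ) [hp : Fact p.Prime] (F : Type) [Field F] [Fintype F]
    [Algebra (ZMod p) F] (hF : Fintype.card F = p ^ n) :
    ∃ ψ : AddChar F ℂ, IsTraceChar p n ψ := by
  have hr : Module.finrank (ZMod p) F = n := by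
    have h := Module.card_eq_pow_finrank (K := ZMod p) (V := F)
    rw [hF, ZMod.card] at h
    exact (Nat.pow_right_injective hp.out.two_le h).symm
  have htr : ∀ y : F, algebraMap (ZMod p) F (Algebra.trace (ZMod p) F y) = trSum p 1 n y := by
    intro y
    rw [FiniteField.algebraMap_trace_eq_sum_pow, hr, trSum, Nat.card_zmod]
    simp
  refine ⟨(ZMod.stdAddChar (N := p)).compAddMonoidHom
    (Algebra.trace (ZMod p) F).toAddMonoidHom, ?_, ?_⟩
  · obtain ⟨x, hx⟩ := Algebra.trace_surjective (ZMod p) F 1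
    rw [AddChar.ne_one_iff]
    refine ⟨x, fun h => ?_⟩
    have h' : ZMod.stdAddChar (N := p) 1 = ZMod.stdAddChar (N := p) 0 := by
      simpa [hx] using h
    exact one_ne_zero (ZMod.injective_stdAddChar h')
  · intro y hy
    have : Algebra.trace (ZMod p) F y = 0 := by
      rw [← htr] at hy
      simpa using hy
    simp [this]

section TraceChar

variable {F : Type} [Field F] [Fintype F] {p n : ℕ} [hp : Fact p.Prime] [CharP F p]
  {ψ : AddChar F ℂ}

lemma sum_addChar_mul (hψ : ψ ≠ 1) (a : F) :
    ∑ x : F, ψ (x * a) = if a = 0 then (Fintype.card F : ℂ) else 0 := by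
  have := AddChar.sum_mulShift (R := F) a (AddChar.IsPrimitive.of_ne_one hψ)
  simpa using this

lemma IsTraceChar.pow_char_pow (hψ : IsTraceChar p n ψ) (hF : Fintype.card F = p ^ n) (j : ℕ)
    (x : F) : ψ (x ^ p ^ j) = ψ x := by
  induction j with
  | zero => simp
  | succ j ih =>
    rw [← ih, pow_succ, pow_mul]
    set y := x ^ p ^ j
    have h : ψ (y ^ p - y) = 1 := by
      apply hψ.eq_one_of_trSum
      have h1 := trSum_add (p := p) 1 n (y ^ p - y) y
      have h2 := trSum_pow_char_pow (p := p) 1 n y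
      rw [trSum_fixed (by rw [one_mul, ← hF, FiniteField.pow_card])] at h2
      rw [sub_add_cancel] at h1
      rw [pow_one] at h2
      rwa [← h2, right_eq_add] at h1
    rw [← sub_add_cancel (y ^ p) y, AddChar.map_add_eq_mul, h, one_mul]

/-- Orthogonality over the subfield of size `p ^ t`. -/
lemma IsTraceChar.sum_frobFixed (hψ : IsTraceChar p n ψ) (hF : Fintype.card F = p ^ n) {t : ℕ}
    (ht0 : 0 < t) (ht : t ∣ n) (y : F) :
    ∑ a ∈ frobFixed F p t, ψ (a * y) = if trSum p t (n / t) y = 0 then (p : ℂ) ^ t else 0 := by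
  have hn : t * (n / t) = n := Nat.mul_div_cancel' ht
  have htr : ∀ z : F, trSum p 1 n z = trSum p 1 t (trSum p t (n / t) z) := fun z => by
    rw [trSum_trSum, hn]
  have hψt : ∀ z : F, trSum p t (n / t) z = 0 → ψ z = 1 := fun z hz =>
    hψ.eq_one_of_trSum z (by
      rw [htr, hz]
      simp [trSum, hp.out.ne_zero])
  have hfix : ∀ z : F, trSum p t (n / t) z ^ p ^ t = trSum p t (n / t) z := fun z =>
    trSum_fixed (by rw [hn, ← hF, FiniteField.pow_card])
  split_ifs with hy
  · rw [Finset.sum_congr rfl (g := fun _ => (1 : ℂ)), Finset.sum_const,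
      card_frobFixed hF ht0 ht]
    · simp
    · intro a ha
      apply hψt
      rw [trSum_mul_of_fixed (mem_frobFixed.1 ha), hy, mul_zero]
  · obtain ⟨x, hx⟩ := AddChar.ne_one_iff.1 hψ.ne_one
    set b := trSum p t (n / t) x / trSum p t (n / t) y with hb
    have hbf : b ^ p ^ t = b := by rw [hb, div_pow, hfix, hfix]
    have hne : ψ (b * y) ≠ 1 := by
      have h1 : ψ (x - b * y) = 1 := by
        apply hψt
        have h2 := trSum_add (p := p) t (n / t) (x - b * y) (b * y)
        rw [sub_add_cancel, trSum_mul_of_fixed hbf, hb, div_mul_cancel₀ _ hy] at h2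
        exact right_eq_add.1 h2
      intro h
      apply hx
      rw [← sub_add_cancel x (b * y), AddChar.map_add_eq_mul, h1, h, one_mul]
    have h : ψ (b * y) * ∑ a ∈ frobFixed F p t, ψ (a * y) = ∑ a ∈ frobFixed F p t, ψ (a * y) := by
      rw [Finset.mul_sum]
      refine Finset.sum_nbij' (fun a => b + a) (fun a => a - b) ?_ ?_ ?_ ?_ ?_
      · intro a ha
        rw [mem_frobFixed] at ha ⊢
        rw [add_pow_char_pow, ha, hbf]
      · intro a ha
        rw [mem_frobFixed] at ha ⊢
        rw [sub_pow_char_pow, ha, hbf]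
      · simp
      · simp
      · intro a _
        rw [add_mul, AddChar.map_add_eq_mul]
    by_contra h0
    exact hne (mul_right_cancel₀ h0 (by rw [h, one_mul]))

end TraceChar

section SemilinearEquations

variable {F : Type} [Field F] [Fintype F] (σ : F →+* F)

lemma card_first_order_le {A : F} (hA : A ≠ 0) (C : F) :
    (Finset.univ.filter fun u : F => A * σ u = C * u).card ≤
      (Finset.univ.filter fun u : F => σ u = u).card := by
  by_cases h : ∃ v : F, v ≠ 0 ∧ A * σ v = C * v
  · obtain ⟨v, hv0, hv⟩ := h
    have hσv : σ v ≠ 0 := (map_ne_zero σ).2 hv0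
    refine Finset.card_le_card_of_injOn (fun u => u / v) ?_ ?_
    · intro u hu
      simp only [Finset.coe_filter, Finset.mem_univ, true_and, Set.mem_ofPred_eq] at hu ⊢
      rw [map_div₀, div_eq_div_iff hσv hv0]
      apply mul_left_cancel₀ hA
      linear_combination v * hu - u * hv
    · intro u _ w _ huw
      exact (div_left_inj' hv0).1 huw
  · push Not at h
    refine Finset.card_le_card fun u hu => ?_
    simp only [Finset.mem_filter, Finset.mem_univ, true_and] at hu ⊢
    have : u = 0 := by
      by_contra hu0
      exact h u hu0 hu
    simp [this]

lemma card_second_order_le {A : F} (hA : A ≠ 0) (B C : F) :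
    (Finset.univ.filter fun z : F => A * σ (σ z) + B * σ z + C * z = 0).card ≤
      (Finset.univ.filter fun u : F => σ u = u).card *
        (Finset.univ.filter fun u : F => σ u = u).card := by
  have hpos : 0 < (Finset.univ.filter fun u : F => σ u = u).card :=
    Finset.card_pos.2 ⟨0, by simp⟩
  by_cases h : ∃ v : F, v ≠ 0 ∧ A * σ (σ v) + B * σ v + C * v = 0
  · obtain ⟨v, hv0, hv⟩ := h
    have hA' : A * σ (σ v) ≠ 0 := mul_ne_zero hA (by simpa using hv0)
    refine (Finset.card_le_mul_card_image_of_maps_to (f := fun z => σ (z / v) - z / v)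
      (t := Finset.univ.filter fun u : F => A * σ (σ v) * σ u = C * v * u) ?_
      (Finset.univ.filter fun u : F => σ u = u).card ?_).trans
      (Nat.mul_le_mul le_rfl (card_first_order_le σ hA' _))
    · intro z hz
      simp only [Finset.mem_filter, Finset.mem_univ, true_and] at hz ⊢
      obtain ⟨w, rfl⟩ : ∃ w, z = w * v := ⟨z / v, (div_mul_cancel₀ z hv0).symm⟩
      simp only [mul_div_cancel_right₀ _ hv0, map_sub, map_mul] at hz ⊢
      linear_combination hz - σ w * hv
    · intro b _
      rcases Finset.eq_empty_or_nonempty (Finset.filter (fun z => σ (z / v) - z / v = b)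
        (Finset.univ.filter fun z : F => A * σ (σ z) + B * σ z + C * z = 0)) with he | ⟨w, hw⟩
      · rw [he]
        simp
      · simp only [Finset.mem_filter, Finset.mem_univ, true_and] at hw
        refine Finset.card_le_card_of_injOn (fun z => z / v - w / v) ?_ ?_
        · intro z hz
          simp only [Finset.coe_filter, Finset.mem_filter, Finset.mem_univ, true_and,
            Set.mem_ofPred_eq] at hz ⊢
          rw [map_sub]
          linear_combination hz.2 - hw.2
        · intro y _ z _ hyz
          exact (div_left_inj' hv0).1 (sub_left_injective hyz)
  · push Not at h
    refine (Finset.card_le_card (t := {0}) fun u hu => ?_).trans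
      ((Finset.card_singleton (0 : F)).trans_le (Nat.mul_pos hpos hpos))
    simp only [Finset.mem_filter, Finset.mem_univ, true_and] at hu
    rw [Finset.mem_singleton]
    by_contra hu0
    exact h u hu0 hu

end SemilinearEquations

/-- Numerical conditions under which the forms below are Hermitian over `F_{p^{2d}}`. -/
structure OddMultiples (d m k n : ℕ) : Prop where
  d_pos : 0 < d
  m_eq : ∃ s, Odd s ∧ m = d * s
  k_eq : ∃ r, Odd r ∧ k = d * r
  gcd_eq : Nat.gcd m k = d
  n_eq : n = 2 * m
  k_le : k ≤ n

namespace OddMultiples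

variable {d m k n : ℕ} (h : OddMultiples d m k n)
include h

lemma two_mul_dvd : 2 * d ∣ n := by
  obtain ⟨s, -, hs⟩ := h.m_eq
  exact ⟨s, by rw [h.n_eq, hs, mul_assoc]⟩

lemma m_pos : 0 < m := by
  obtain ⟨s, hs, rfl⟩ := h.m_eq
  exact Nat.mul_pos h.d_pos hs.pos

lemma sub_eq : ∃ r, Odd r ∧ n - k = d * r := by
  obtain ⟨s, hs, hm⟩ := h.m_eq
  obtain ⟨r, hr, hk⟩ := h.k_eq
  have hle : r ≤ 2 * s := by
    refine Nat.le_of_mul_le_mul_left (c := d) ?_ h.d_pos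
    have := h.k_le
    rw [h.n_eq, hm, hk] at this
    linarith
  refine ⟨2 * s - r, Nat.Even.sub_odd hle (even_two_mul s) hr, ?_⟩
  rw [h.n_eq, hm, hk, Nat.mul_sub]
  congr 1
  ring

lemma gcd_two_mul : Nat.gcd (2 * m) (2 * k) = 2 * d := by
  rw [Nat.gcd_mul_left, h.gcd_eq]

lemma gcd_add_dvd : Nat.gcd (m + k) n ∣ 2 * d := by
  rw [← h.gcd_two_mul]
  have hm : Nat.gcd (m + k) n ∣ 2 * m := h.n_eq ▸ Nat.gcd_dvd_right (m + k) n
  refine Nat.dvd_gcd hm ((Nat.dvd_add_right hm).1 ?_)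
  rw [← mul_add]
  exact (Nat.gcd_dvd_left _ _).mul_left 2

variable {F : Type} [Field F] {p : ℕ} {c : F} (hc : c ^ p ^ (2 * d) = c)
include hc

lemma pow_pow_m : c ^ p ^ m = c ^ p ^ d := by
  obtain ⟨s, hs, hm⟩ := h.m_eq
  rw [hm, pow_pow_odd_mul hc hs]

lemma pow_pow_k : c ^ p ^ k = c ^ p ^ d := by
  obtain ⟨s, hs, hm⟩ := h.k_eq
  rw [hm, pow_pow_odd_mul hc hs]

lemma pow_pow_sub : c ^ p ^ (n - k) = c ^ p ^ d := by
  obtain ⟨s, hs, hm⟩ := h.sub_eq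
  rw [hm, pow_pow_odd_mul hc hs]

end OddMultiples

/-- The form whose trace is the quadratic form attached to `(α, β)`. -/
def hermForm (p m k : ℕ) {F : Type} [Field F] (α β x : F) : F :=
  α / 2 * x ^ (p ^ m + 1) + β * x ^ (p ^ k + 1)

/-- The exponential sum attached to `(α, β)`. -/
def formSum (p m k : ℕ) {F : Type} [Field F] [Fintype F] (ψ : AddChar F ℂ) (α β : F) : ℂ :=
  ∑ x : F, ψ (hermForm p m k α β x)

lemma hermForm_smul (p m k : ℕ) {F : Type} [Field F] (a α β x : F) :
    hermForm p m k (a * α) (a * β) x = a * hermForm p m k α β x := by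
  simp only [hermForm]
  ring

lemma OddMultiples.hermForm_mul {d m k n : ℕ} (h : OddMultiples d m k n) {F : Type} [Field F]
    {p : ℕ} {c : F} (hc : c ^ p ^ (2 * d) = c) (α β x : F) :
    hermForm p m k α β (c * x) = c ^ (p ^ d + 1) * hermForm p m k α β x := by
  simp only [hermForm, pow_succ, mul_pow, h.pow_pow_m hc, h.pow_pow_k hc]
  ring

lemma exists_pow_succ_eq {p d n : ℕ} [hp : Fact p.Prime] {F : Type} [Field F] [Fintype F]
    (hF : Fintype.card F = p ^ n) (hd : 2 * d ∣ n) {a : F} (ha : a ^ p ^ d = a)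
    (ha0 : a ≠ 0) (hd0 : 0 < d) :
    ∃ c : F, c ≠ 0 ∧ c ^ p ^ (2 * d) = c ∧ c ^ (p ^ d + 1) = a := by
  obtain ⟨g, hg⟩ := IsCyclic.exists_generator (α := Fˣ)
  have ho : orderOf g = p ^ n - 1 := by
    rw [orderOf_eq_card_of_forall_mem_zpowers hg, Nat.card_eq_fintype_card,
      Fintype.card_units, hF]
  have hQ : 1 < p ^ d := Nat.one_lt_pow hd0.ne' hp.out.one_lt
  obtain ⟨e, he⟩ : p ^ (2 * d) - 1 ∣ p ^ n - 1 := by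
    obtain ⟨r, rfl⟩ := hd
    rw [pow_mul p (2 * d)]
    simpa only [one_pow] using Nat.sub_dvd_pow_sub_pow (p ^ (2 * d)) 1 r
  have hQQ : p ^ (2 * d) - 1 = (p ^ d - 1) * (p ^ d + 1) := by
    have := Nat.sq_sub_sq (p ^ d) 1
    rw [mul_comm, ← pow_mul, mul_comm d 2, one_pow] at this
    exact this.trans (by ring)
  obtain ⟨i, hi⟩ := mem_powers_iff_mem_zpowers.2 (hg (Units.mk0 a ha0))
  have hi' : g ^ i = Units.mk0 a ha0 := hi
  have h1 : g ^ (i * (p ^ d - 1)) = 1 := by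
    rw [pow_mul, hi']
    ext
    simp only [Units.val_pow_eq_pow_val, Units.val_mk0, Units.val_one]
    apply mul_right_cancel₀ ha0
    rw [← pow_succ, Nat.sub_add_cancel hQ.le, ha, one_mul]
  have h2 := orderOf_dvd_of_pow_eq_one h1
  rw [ho, he, hQQ, mul_comm i, mul_assoc] at h2
  obtain ⟨j, rfl⟩ := Nat.dvd_of_mul_dvd_mul_left (Nat.sub_pos_of_lt hQ) h2
  refine ⟨((g ^ (e * j) : Fˣ) : F), Units.ne_zero _, ?_, ?_⟩
  · rw [← Units.val_pow_eq_pow_val]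
    congr 1
    rw [← Nat.sub_add_cancel (Nat.one_le_pow (2 * d) p hp.out.pos), pow_succ, mul_eq_right,
      ← pow_mul, show e * j * (p ^ (2 * d) - 1) = (p ^ (2 * d) - 1) * e * j by ring, ← he, ← ho,
      pow_mul, pow_orderOf_eq_one, one_pow]
  · rw [← Units.val_pow_eq_pow_val, ← pow_mul,
      show e * j * (p ^ d + 1) = (p ^ d + 1) * e * j by ring, hi', Units.val_mk0]

section Polarization

variable {F : Type} [Field F] {p : ℕ} [hp : Fact p.Prime] [CharP F p]

lemma hermForm_add (m k : ℕ) (α β y z : F) :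
    hermForm p m k α β (y + z) - hermForm p m k α β y = hermForm p m k α β z +
      (α / 2 * (y ^ p ^ m * z + y * z ^ p ^ m) + β * (y ^ p ^ k * z + y * z ^ p ^ k)) := by
  simp only [hermForm, pow_succ _ (p ^ _), add_pow_char_pow]
  ring

lemma two_pow_char_pow (j : ℕ) : (2 : F) ^ p ^ j = 2 := by
  rw [← one_add_one_eq_two, add_pow_char_pow, one_pow]

end Polarization

section FormSums

variable {F : Type} [Field F] [Fintype F] {p d m k n : ℕ} [hp : Fact p.Prime]
  (h : OddMultiples d m k n) (hF : Fintype.card F = p ^ n) {ψ : AddChar F ℂ}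

include h hF in
lemma formSum_smul {a : F} (ha : a ^ p ^ d = a) (ha0 : a ≠ 0) (α β : F) :
    formSum p m k ψ (a * α) (a * β) = formSum p m k ψ α β := by
  obtain ⟨c, hc0, hc, rfl⟩ := exists_pow_succ_eq hF h.two_mul_dvd ha ha0 h.d_pos
  simp only [formSum, hermForm_smul, ← h.hermForm_mul hc]
  exact Fintype.sum_equiv (Equiv.mulLeft₀ c hc0) _ _ fun x => rfl

include h hF in
lemma formSum_eq_sum_neg (hodd : Odd p) (α β : F) :
    formSum p m k ψ α β = ∑ y : F, ψ (-hermForm p m k α β y) := by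
  rw [← formSum_smul h hF (a := -1) hodd.pow.neg_one_pow (neg_ne_zero.2 one_ne_zero)]
  simp only [formSum, hermForm_smul]
  simp only [neg_one_mul]

variable [CharP F p]

include h hF in
lemma addChar_bilin (hψ : IsTraceChar p n ψ) (h2 : (2 : F) ≠ 0) {α : F} (hα : α ^ p ^ m = α)
    (β y z : F) :
    ψ (α / 2 * (y ^ p ^ m * z + y * z ^ p ^ m) + β * (y ^ p ^ k * z + y * z ^ p ^ k)) =
      ψ (y * phiMap p m n k α β z) := by
  have hn : ∀ w : F, w ^ p ^ n = w := fun w => by rw [← hF, FiniteField.pow_card]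
  have h1 : ψ (α / 2 * (y ^ p ^ m * z)) = ψ (α / 2 * (y * z ^ p ^ m)) := by
    rw [← hψ.pow_char_pow hF m]
    congr 1
    rw [mul_pow, mul_pow, div_pow, hα, two_pow_char_pow, ← pow_mul, ← pow_add, ← two_mul,
      ← h.n_eq, hn]
  have h3 : ψ (β * (y ^ p ^ k * z)) = ψ (y * (β ^ p ^ (n - k) * z ^ p ^ (n - k))) := by
    rw [← hψ.pow_char_pow hF (n - k)]
    congr 1
    rw [mul_pow, mul_pow, ← pow_mul, ← pow_add, Nat.add_sub_cancel' h.k_le, hn]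
    ring
  rw [mul_add, mul_add, AddChar.map_add_eq_mul, AddChar.map_add_eq_mul, AddChar.map_add_eq_mul,
    h1, h3, ← AddChar.map_add_eq_mul, ← AddChar.map_add_eq_mul, ← AddChar.map_add_eq_mul]
  congr 1
  rw [phiMap]
  field_simp
  ring

include h hF in
lemma formSum_sq (hψ : IsTraceChar p n ψ) (h2 : (2 : F) ≠ 0) (hodd : Odd p) {α : F}
    (hα : α ^ p ^ m = α) (β : F) :
    formSum p m k ψ α β ^ 2 =
      (p : ℂ) ^ n * (Finset.univ.filter fun z : F => phiMap p m n k α β z = 0).card := by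
  have hneg := formSum_eq_sum_neg h hF hodd (ψ := ψ) α β
  have hrad : ∀ z : F, phiMap p m n k α β z = 0 → ψ (hermForm p m k α β z) = 1 := by
    intro z hz
    have hb := addChar_bilin h hF hψ h2 hα β z z
    rw [hz, mul_zero, AddChar.map_zero_eq_one,
      show α / 2 * (z ^ p ^ m * z + z * z ^ p ^ m) + β * (z ^ p ^ k * z + z * z ^ p ^ k) =
        2 • hermForm p m k α β z by rw [hermForm]; ring, AddChar.map_nsmul_eq_pow] at hb
    have hpp : ψ (hermForm p m k α β z) ^ p = 1 := by
      rw [← AddChar.map_nsmul_eq_pow, nsmul_eq_mul, CharP.cast_eq_zero, zero_mul,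
        AddChar.map_zero_eq_one]
    obtain ⟨i, hi⟩ := hodd
    have hodd' : ∀ w : ℂ, w ^ 2 = 1 → w ^ p = 1 → w = 1 := fun w h2 hp => by
      rwa [hi, pow_succ, pow_mul, h2, one_pow, one_mul] at hp
    exact hodd' _ hb hpp
  calc formSum p m k ψ α β ^ 2
      = ∑ y : F, ∑ x : F, ψ (hermForm p m k α β x - hermForm p m k α β y) := by
        rw [sq]
        nth_rewrite 2 [hneg]
        rw [formSum, Finset.sum_mul_sum, Finset.sum_comm]
        simp only [← AddChar.map_add_eq_mul, sub_eq_add_neg]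
    _ = ∑ y : F, ∑ z : F, ψ (hermForm p m k α β z) * ψ (y * phiMap p m n k α β z) := by
        refine Finset.sum_congr rfl fun y _ => ?_
        refine (Fintype.sum_equiv (Equiv.addLeft y) _ _ fun z => ?_).symm
        rw [Equiv.coe_addLeft, hermForm_add, AddChar.map_add_eq_mul,
          addChar_bilin h hF hψ h2 hα]
    _ = ∑ z : F, if phiMap p m n k α β z = 0 then (p : ℂ) ^ n else 0 := by
        rw [Finset.sum_comm]
        refine Finset.sum_congr rfl fun z _ => ?_
        rw [← Finset.mul_sum, sum_addChar_mul hψ.ne_one, hF]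
        split_ifs with hz
        · rw [hrad z hz, one_mul, Nat.cast_pow]
        · rw [mul_zero]
    _ = _ := by
        rw [← Finset.sum_filter, Finset.sum_const, nsmul_eq_mul, mul_comm]

include h hF in
lemma card_radical_le {α β : F} (hαβ : ¬(α = 0 ∧ β = 0)) :
    (Finset.univ.filter fun z : F => phiMap p m n k α β z = 0).card ≤
      p ^ (2 * d) * p ^ (2 * d) := by
  have hn : ∀ w : F, w ^ p ^ n = w := fun w => by rw [← hF, FiniteField.pow_card]
  by_cases hβ : β = 0
  · have hα : α ≠ 0 := fun hα => hαβ ⟨hα, hβ⟩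
    refine (Finset.card_le_card (t := {0}) fun z hz => ?_).trans
      ((Finset.card_singleton (0 : F)).trans_le
        (Nat.mul_pos (pow_pos hp.out.pos _) (pow_pos hp.out.pos _)))
    simpa [phiMap, hβ, hα, hp.out.ne_zero] using hz
  · set σ := iterateFrobenius F p (m + k)
    have hσ : ∀ z, σ z = z ^ p ^ (m + k) := fun z => iterateFrobenius_def ..
    have hfix : (Finset.univ.filter fun u : F => σ u = u).card ≤ p ^ (2 * d) := by
      rw [← card_frobFixed hF (Nat.mul_pos two_pos h.d_pos) h.two_mul_dvd]
      refine Finset.card_le_card fun u hu => ?_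
      rw [Finset.mem_filter, hσ] at hu
      exact mem_frobFixed.2
        (pow_pow_eq_self_of_dvd (pow_pow_eq_self_gcd hu.2 (hn u)) h.gcd_add_dvd)
    refine (Finset.card_le_card fun z hz => ?_).trans
      ((card_second_order_le σ (pow_ne_zero (p ^ k) hβ) (α ^ p ^ k) β).trans
        (Nat.mul_le_mul hfix hfix))
    simp only [Finset.mem_filter, Finset.mem_univ, true_and] at hz ⊢
    have h1 := congrArg (· ^ p ^ k) hz
    simp only [phiMap, add_pow_char_pow, mul_pow, ← pow_mul, ← pow_add,
      Nat.sub_add_cancel h.k_le, hn, zero_pow (pow_ne_zero k hp.out.ne_zero)] at h1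
    have h2 : z ^ p ^ (k + k) = σ (σ z) := by
      rw [hσ, hσ, ← pow_mul, ← pow_add, show m + k + (m + k) = n + (k + k) by
        rw [h.n_eq]; ring, pow_add p n, pow_mul, hn]
    rw [← h2, hσ]
    linear_combination h1

include h hF in
lemma exists_card_radical_eq (α β : F) :
    ∃ r, (Finset.univ.filter fun z : F => phiMap p m n k α β z = 0).card = p ^ (2 * d * r) := by
  set K : Subfield F := (iterateFrobenius F p (2 * d)).eqLocusField (RingHom.id F)
  have hK : ∀ c : F, c ∈ K ↔ c ^ p ^ (2 * d) = c := fun c => by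
    rw [RingHom.mem_eqLocusField, iterateFrobenius_def, RingHom.id_apply]
  have hcard : Nat.card K = p ^ (2 * d) := by
    rw [← card_frobFixed hF (Nat.mul_pos two_pos h.d_pos) h.two_mul_dvd,
      ← SetLike.coe_sort_coe, Nat.card_coe_set_eq, ← Set.ncard_coe_finset]
    congr 1
    ext c
    simp [hK, mem_frobFixed]
  let V : Submodule K F :=
    { carrier := {z | phiMap p m n k α β z = 0}
      zero_mem' := by simp [phiMap, hp.out.ne_zero]
      add_mem' := by
        intro y z hy hz
        simp only [Set.mem_ofPred_eq, phiMap, add_pow_char_pow] at hy hz ⊢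
        linear_combination hy + hz
      smul_mem' := by
        intro c z hz
        have hc := (hK c).1 c.2
        simp only [Set.mem_ofPred_eq, phiMap, Subfield.smul_def, smul_eq_mul, mul_pow,
          h.pow_pow_m hc, h.pow_pow_k hc, h.pow_pow_sub hc] at hz ⊢
        linear_combination (c : F) ^ p ^ d * hz }
  refine ⟨Module.finrank K V, ?_⟩
  rw [pow_mul, ← hcard, ← Module.natCard_eq_pow_finrank (K := K) (V := V),
    ← SetLike.coe_sort_coe, Nat.card_coe_set_eq, ← Set.ncard_coe_finset]
  congr 1
  ext z
  simp only [Finset.coe_filter, Finset.mem_univ, true_and]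
  rfl

end FormSums

section Moments

variable {F : Type} [Field F] [Fintype F] {p d m k n : ℕ} [hp : Fact p.Prime]
  (h : OddMultiples d m k n) (hF : Fintype.card F = p ^ n)

omit hp in
include h hF in
lemma pow_succ_pow_pow (x : F) : (x ^ (p ^ m + 1)) ^ p ^ m = x ^ (p ^ m + 1) := by
  have hn : x ^ p ^ n = x := by rw [← hF, FiniteField.pow_card]
  have hx : (x ^ p ^ m) ^ p ^ m = x := by rw [← pow_mul, ← pow_add, ← two_mul, ← h.n_eq, hn]
  rw [pow_succ, mul_pow, hx, mul_comm]

omit [Fintype F] hp in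
include h in
lemma pow_succ_eq_one_iff (c : F) :
    c ^ (p ^ m + 1) = 1 ∧ c ^ (p ^ k + 1) = 1 ↔ c ^ (p ^ d + 1) = 1 := by
  have hinv : ∀ j, c ^ (p ^ j + 1) = 1 → c ^ p ^ (2 * j) = c := fun j hj => by
    rw [pow_succ] at hj
    rw [two_mul, pow_add, pow_mul, eq_inv_of_mul_eq_one_left hj, inv_pow,
      eq_inv_of_mul_eq_one_left hj, inv_inv]
  constructor
  · rintro ⟨hm, hk⟩
    have hc := pow_pow_eq_self_gcd (hinv m hm) (hinv k hk)
    rw [h.gcd_two_mul] at hc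
    rwa [pow_succ, ← h.pow_pow_m hc, ← pow_succ]
  · intro hd
    have hc := hinv d hd
    constructor
    · rwa [pow_succ, h.pow_pow_m hc, ← pow_succ]
    · rwa [pow_succ, h.pow_pow_k hc, ← pow_succ]

omit hp in
include h hF in
lemma card_common_pow_succ {y : F} (hy : y ≠ 0) :
    (Finset.univ.filter fun x : F =>
      x ^ (p ^ m + 1) = y ^ (p ^ m + 1) ∧ x ^ (p ^ k + 1) = y ^ (p ^ k + 1)).card =
      p ^ d + 1 := by
  have hdvd : p ^ d + 1 ∣ Fintype.card F - 1 := by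
    obtain ⟨r, hr⟩ := h.two_mul_dvd
    rw [hF, hr, pow_mul]
    refine Dvd.dvd.trans ?_ (by
      simpa only [one_pow] using Nat.sub_dvd_pow_sub_pow (p ^ (2 * d)) 1 r)
    rw [mul_comm 2 d, pow_mul]
    exact ⟨p ^ d - 1, by simpa using Nat.sq_sub_sq (p ^ d) 1⟩
  rw [← card_filter_pow_eq_one (F := F) hdvd (Nat.succ_pos _)]
  refine Finset.card_nbij' (fun x => x / y) (fun c => c * y) ?_ ?_ ?_ ?_
  · intro x hx
    simp only [Finset.mem_coe, Finset.mem_filter, Finset.mem_univ, true_and] at hx ⊢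
    rw [← pow_succ_eq_one_iff h, div_pow, div_pow, div_eq_one_iff_eq (pow_ne_zero _ hy),
      div_eq_one_iff_eq (pow_ne_zero _ hy)]
    exact hx
  · intro c hc
    simp only [Finset.mem_coe, Finset.mem_filter, Finset.mem_univ, true_and] at hc ⊢
    rw [← pow_succ_eq_one_iff h] at hc
    rw [mul_pow, mul_pow, hc.1, hc.2, one_mul, one_mul]
    exact ⟨rfl, rfl⟩
  · intro x _
    exact div_mul_cancel₀ x hy
  · intro c _
    exact mul_div_cancel_right₀ c hy

variable [CharP F p] {ψ : AddChar F ℂ}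

include h hF in
lemma sum_sum_addChar (hψ : IsTraceChar p n ψ) (h2 : (2 : F) ≠ 0) {u : F}
    (hu : u ^ p ^ m = u) (v : F) :
    ∑ α ∈ frobFixed F p m, ∑ β : F, ψ (α / 2 * u + β * v) =
      if u = 0 ∧ v = 0 then (p : ℂ) ^ m * (p : ℂ) ^ n else 0 := by
  have hmn : m ∣ n := ⟨2, by rw [h.n_eq, mul_comm]⟩
  have hnm : n / m = 2 * 1 := by rw [h.n_eq, Nat.mul_div_cancel _ h.m_pos]
  have htr : trSum p m (n / m) (u / 2) = u := by
    rw [hnm, trSum_two_mul_half h2 (by rwa [mul_one])]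
    simp [trSum]
  have h1 := hψ.sum_frobFixed hF h.m_pos hmn (u / 2)
  rw [htr] at h1
  have h3 := sum_addChar_mul hψ.ne_one v
  rw [hF, Nat.cast_pow] at h3
  calc ∑ α ∈ frobFixed F p m, ∑ β : F, ψ (α / 2 * u + β * v)
      = (∑ α ∈ frobFixed F p m, ψ (α * (u / 2))) * ∑ β : F, ψ (β * v) := by
        rw [Finset.sum_mul_sum]
        refine Finset.sum_congr rfl fun α _ => Finset.sum_congr rfl fun β _ => ?_
        rw [AddChar.map_add_eq_mul]
        congr 2
        ring
    _ = _ := by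
        rw [h1, h3]
        split_ifs <;> simp_all

include h hF in
lemma sum_formSum (hψ : IsTraceChar p n ψ) (h2 : (2 : F) ≠ 0) :
    ∑ α ∈ frobFixed F p m, ∑ β : F, formSum p m k ψ α β = (p : ℂ) ^ m * (p : ℂ) ^ n := by
  calc ∑ α ∈ frobFixed F p m, ∑ β : F, formSum p m k ψ α β
      = ∑ x : F, ∑ α ∈ frobFixed F p m, ∑ β : F, ψ (hermForm p m k α β x) := by
        exact (Finset.sum_congr rfl fun α _ => Finset.sum_comm).trans Finset.sum_comm
    _ = ∑ x : F, if x = 0 then (p : ℂ) ^ m * (p : ℂ) ^ n else 0 := by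
        refine Finset.sum_congr rfl fun x _ => ?_
        simp only [hermForm]
        rw [sum_sum_addChar h hF hψ h2 (pow_succ_pow_pow h hF x)]
        simp
    _ = _ := by simp

include h hF in
lemma sum_formSum_sq (hψ : IsTraceChar p n ψ) (h2 : (2 : F) ≠ 0) (hodd : Odd p) :
    ∑ α ∈ frobFixed F p m, ∑ β : F, formSum p m k ψ α β ^ 2 =
      (p : ℂ) ^ m * (p : ℂ) ^ n * (1 + ((p : ℂ) ^ n - 1) * ((p : ℂ) ^ d + 1)) := by
  have hsq : ∀ α β : F, formSum p m k ψ α β ^ 2 =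
      ∑ y : F, ∑ x : F, ψ (α / 2 * (x ^ (p ^ m + 1) - y ^ (p ^ m + 1)) +
        β * (x ^ (p ^ k + 1) - y ^ (p ^ k + 1))) := by
    intro α β
    rw [sq]
    nth_rewrite 2 [formSum_eq_sum_neg h hF hodd]
    rw [formSum, Finset.sum_mul_sum, Finset.sum_comm]
    refine Finset.sum_congr rfl fun y _ => Finset.sum_congr rfl fun x _ => ?_
    rw [← AddChar.map_add_eq_mul]
    congr 1
    simp only [hermForm]
    ring
  have hcard : ∀ y : F, (Finset.univ.filter fun x : F =>
      x ^ (p ^ m + 1) = y ^ (p ^ m + 1) ∧ x ^ (p ^ k + 1) = y ^ (p ^ k + 1)).card =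
        if y = 0 then 1 else p ^ d + 1 := by
    intro y
    split_ifs with hy
    · rw [← Finset.card_singleton (0 : F)]
      congr 1
      ext x
      simp [hy]
    · exact card_common_pow_succ h hF hy
  calc ∑ α ∈ frobFixed F p m, ∑ β : F, formSum p m k ψ α β ^ 2
      = ∑ y : F, ∑ x : F, ∑ α ∈ frobFixed F p m, ∑ β : F,
          ψ (α / 2 * (x ^ (p ^ m + 1) - y ^ (p ^ m + 1)) +
            β * (x ^ (p ^ k + 1) - y ^ (p ^ k + 1))) := by
        simp only [hsq]
        refine (Finset.sum_congr rfl fun α _ => Finset.sum_comm).trans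
          (Finset.sum_comm.trans (Finset.sum_congr rfl fun y _ => ?_))
        exact (Finset.sum_congr rfl fun α _ => Finset.sum_comm).trans Finset.sum_comm
    _ = ∑ y : F, ∑ x : F, if x ^ (p ^ m + 1) = y ^ (p ^ m + 1) ∧
          x ^ (p ^ k + 1) = y ^ (p ^ k + 1) then (p : ℂ) ^ m * (p : ℂ) ^ n else 0 := by
        refine Finset.sum_congr rfl fun y _ => Finset.sum_congr rfl fun x _ => ?_
        rw [sum_sum_addChar h hF hψ h2]
        · simp only [sub_eq_zero]
        · rw [sub_pow_char_pow, pow_succ_pow_pow h hF, pow_succ_pow_pow h hF]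
    _ = (p : ℂ) ^ m * (p : ℂ) ^ n * ∑ y : F, ((if y = 0 then 1 else p ^ d + 1 : ℕ) : ℂ) := by
        rw [Finset.mul_sum]
        refine Finset.sum_congr rfl fun y _ => ?_
        rw [← Finset.sum_filter, Finset.sum_const, hcard, nsmul_eq_mul, mul_comm]
    _ = _ := by
        congr 1
        rw [← Finset.add_sum_erase _ _ (Finset.mem_univ (0 : F)), if_pos rfl,
          Finset.sum_congr rfl (g := fun _ => (p : ℂ) ^ d + 1)
            (fun y hy => by rw [if_neg (Finset.ne_of_mem_erase hy)]; push_cast; rfl),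
          Finset.sum_const, Finset.card_erase_of_mem (Finset.mem_univ _), Finset.card_univ, hF,
          nsmul_eq_mul, Nat.cast_sub (Nat.one_le_pow _ _ hp.out.pos)]
        push_cast
        ring

end Moments

lemma card_filter_range_mul_of_periodic {P : ℕ → Prop} [DecidablePred P] {L : ℕ}
    (hP : Function.Periodic P L) (M : ℕ) : ((Finset.range (L * M)).filter P).card = M * ((Finset.range L).filter P).card := by
  simp only [← Nat.count_eq_card_filter_range]
  induction M with
  | zero => simp
  | succ M ih =>
    have hPM : ∀ i, P (L * M + i) = P i := fun i => by
      rw [mul_comm, add_comm]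
      exact hP.nat_mul M i
    rw [mul_add, mul_one, Nat.count_add, ih]
    simp only [hPM]
    ring

section Weights

variable {F : Type} [Field F] [Fintype F] {p d m k n t : ℕ} [hp : Fact p.Prime]
  (h : OddMultiples d m k n) (hF : Fintype.card F = p ^ n) (ht0 : 0 < t) (ht : t ∣ d)

omit hp in
include hF in
lemma formSum_zero_zero (ψ : AddChar F ℂ) : formSum p m k ψ (0 : F) 0 = (p : ℂ) ^ n := by
  simp [formSum, hermForm, hF]

include h ht in
lemma OddMultiples.dvd_m : t ∣ m := by
  obtain ⟨s, -, hs⟩ := h.m_eq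
  exact hs ▸ ht.mul_right s

include h ht in
lemma OddMultiples.dvd_n : t ∣ n := h.n_eq ▸ (h.dvd_m ht).mul_left 2

omit hp in
include hF in
lemma bijOn_pow_range (h2 : (2 : F) ≠ 0) {π : F} (hπ : ∀ x : F, x ≠ 0 → ∃ i : ℕ, π ^ i = x) :
    π ≠ 0 ∧ Set.InjOn (π ^ ·) (Finset.range (p ^ n - 1)) ∧
      (Finset.range (p ^ n - 1)).image (π ^ ·) = Finset.univ.erase 0 := by
  have hπ0 : π ≠ 0 := by
    rintro rfl
    obtain ⟨i, hi⟩ := hπ (-1) (neg_ne_zero.2 one_ne_zero)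
    rcases Nat.eq_zero_or_pos i with rfl | hi0
    · apply h2
      rw [pow_zero] at hi
      linear_combination hi
    · rw [zero_pow hi0.ne'] at hi
      exact neg_ne_zero.2 one_ne_zero hi.symm
  have hord : π ^ (p ^ n - 1) = 1 := hF ▸ FiniteField.pow_card_sub_one_eq_one π hπ0
  have hpos : 0 < p ^ n - 1 := by
    rw [← hF]
    exact Nat.sub_pos_of_lt Fintype.one_lt_card
  have himg : (Finset.range (p ^ n - 1)).image (π ^ ·) = Finset.univ.erase 0 := by
    ext x
    simp only [Finset.mem_image, Finset.mem_range, Finset.mem_erase, Finset.mem_univ, and_true]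
    constructor
    · rintro ⟨i, -, rfl⟩
      exact pow_ne_zero i hπ0
    · intro hx
      obtain ⟨i, rfl⟩ := hπ x hx
      exact ⟨i % (p ^ n - 1), Nat.mod_lt i hpos, (pow_eq_pow_mod i hord).symm⟩
  refine ⟨hπ0, Finset.card_image_iff.1 ?_, himg⟩
  rw [himg, Finset.card_erase_of_mem (Finset.mem_univ _), Finset.card_univ, hF, Finset.card_range]

variable [CharP F p]

include h hF ht0 ht in
lemma card_trSum_hermForm_eq_zero {ψ : AddChar F ℂ} (hψ : IsTraceChar p n ψ) (α β : F) :
    (p : ℂ) ^ t *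
      (Finset.univ.filter fun x : F => trSum p t (n / t) (hermForm p m k α β x) = 0).card =
      (p : ℂ) ^ n + ((p : ℂ) ^ t - 1) * formSum p m k ψ α β := by
  have htn := h.dvd_n ht
  have h0 : (0 : F) ∈ frobFixed F p t := by simp [mem_frobFixed, hp.out.ne_zero]
  calc (p : ℂ) ^ t *
      (Finset.univ.filter fun x : F => trSum p t (n / t) (hermForm p m k α β x) = 0).card
      = ∑ x : F, ∑ a ∈ frobFixed F p t, ψ (a * hermForm p m k α β x) := by
        simp only [hψ.sum_frobFixed hF ht0 htn]
        rw [← Finset.sum_filter, Finset.sum_const, nsmul_eq_mul, mul_comm]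
    _ = ∑ a ∈ frobFixed F p t, formSum p m k ψ (a * α) (a * β) := by
        rw [Finset.sum_comm]
        simp only [formSum, hermForm_smul]
    _ = _ := by
        rw [← Finset.add_sum_erase _ _ h0, zero_mul, zero_mul, formSum_zero_zero hF,
          Finset.sum_congr rfl (g := fun _ => formSum p m k ψ α β), Finset.sum_const,
          Finset.card_erase_of_mem h0, card_frobFixed hF ht0 htn, nsmul_eq_mul,
          Nat.cast_sub (Nat.one_le_pow _ _ hp.out.pos)]
        · push_cast
          ring
        · intro a ha
          rw [Finset.mem_erase, mem_frobFixed] at ha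
          exact formSum_smul h hF (pow_pow_eq_self_of_dvd ha.2 ht) ha.1 α β

include h hF ht in
lemma wt1_eq_card_range (h2 : (2 : F) ≠ 0) {α : F} (hα : α ^ p ^ m = α) (β π : F) :
    wt1 p m n k t π α β = ((Finset.range (p ^ n - 1)).filter fun i =>
      trSum p t (n / t) (hermForm p m k α β (π ^ i)) ≠ 0).card := by
  have hq : 1 < p ^ n := hF ▸ Fintype.one_lt_card
  have hnt : n / t = 2 * (m / t) := by rw [h.n_eq, Nat.mul_div_assoc 2 (h.dvd_m ht)]
  refine Nat.subtype_card _ fun i => ?_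
  rw [Finset.mem_filter, Finset.mem_range, show i < p ^ n - 1 ↔ i ≤ p ^ n - 2 by omega]
  have hu : (α * π ^ (i * (p ^ m + 1))) ^ p ^ (t * (m / t)) = α * π ^ (i * (p ^ m + 1)) := by
    rw [Nat.mul_div_cancel' (h.dvd_m ht), mul_pow, hα, pow_mul, pow_succ_pow_pow h hF]
  rw [← trSum_two_mul_half h2 hu, ← hnt, ← trSum_add, hermForm, ← pow_mul, ← pow_mul,
    div_mul_eq_mul_div]

include h hF ht0 ht in
lemma pow_mul_wt1 {ψ : AddChar F ℂ} (hψ : IsTraceChar p n ψ) (h2 : (2 : F) ≠ 0) {π : F}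
    (hπ : ∀ x : F, x ≠ 0 → ∃ i : ℕ, π ^ i = x) {α : F} (hα : α ^ p ^ m = α) (β : F) :
    (p : ℂ) ^ t * wt1 p m n k t π α β =
      ((p : ℂ) ^ t - 1) * ((p : ℂ) ^ n - formSum p m k ψ α β) := by
  obtain ⟨-, hinj, himg⟩ := bijOn_pow_range hF h2 hπ
  have hw : wt1 p m n k t π α β = (Finset.univ.filter fun x : F =>
      trSum p t (n / t) (hermForm p m k α β x) ≠ 0).card := by
    rw [wt1_eq_card_range h hF ht h2 hα, ← Finset.card_image_of_injOn
      (hinj.mono (Finset.coe_subset.2 (Finset.filter_subset _ _)))]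
    congr 1
    rw [← Finset.filter_image
      (p := fun x => trSum p t (n / t) (hermForm p m k α β x) ≠ 0), himg, Finset.filter_erase]
    exact Finset.erase_eq_of_notMem fun h0 =>
      (Finset.mem_filter.1 h0).2 (by simp [hermForm, trSum, hp.out.ne_zero])
  have hadd := Finset.card_filter_add_card_filter_not (s := (Finset.univ : Finset F))
    (fun x : F => trSum p t (n / t) (hermForm p m k α β x) = 0)
  rw [Finset.card_univ, hF] at hadd
  have hadd' := congrArg (Nat.cast : ℕ → ℂ) hadd
  push_cast at hadd'
  rw [hw]
  linear_combination (p : ℂ) ^ t * hadd' - card_trSum_hermForm_eq_zero h hF ht0 ht hψ α β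

include h hF ht in
lemma dvd_wt1 (h2 : (2 : F) ≠ 0) {π : F} (hπ : ∀ x : F, x ≠ 0 → ∃ i : ℕ, π ^ i = x)
    {α : F} (hα : α ^ p ^ m = α) (β : F) :
    (p ^ t - 1) * (p ^ d + 1) ∣ wt1 p m n k t π α β := by
  have hdvd : (p ^ t - 1) * (p ^ d + 1) ∣ p ^ (2 * d) - 1 := by
    have hs := Nat.sq_sub_sq (p ^ d) 1
    rw [one_pow, ← pow_mul, mul_comm d 2] at hs
    rw [hs, mul_comm]
    refine mul_dvd_mul_left _ ?_
    obtain ⟨r, rfl⟩ := ht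
    rw [pow_mul]
    simpa using Nat.sub_dvd_pow_sub_pow (p ^ t) 1 r
  have hdvd' : p ^ (2 * d) - 1 ∣ p ^ n - 1 := by
    obtain ⟨r, hr⟩ := h.two_mul_dvd
    rw [hr, pow_mul p (2 * d)]
    simpa only [one_pow] using Nat.sub_dvd_pow_sub_pow (p ^ (2 * d)) 1 r
  obtain ⟨L, hL⟩ := hdvd.trans hdvd'
  have hπ0 := (bijOn_pow_range hF h2 hπ).1
  have hc : (π ^ L) ^ ((p ^ t - 1) * (p ^ d + 1)) = 1 := by
    rw [← pow_mul, mul_comm, ← hL, ← hF, FiniteField.pow_card_sub_one_eq_one π hπ0]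
  have hfix : ∀ (c : F) (j : ℕ), c ^ (p ^ j - 1) = 1 → c ^ p ^ j = c := fun c j hj => by
    rw [← Nat.sub_add_cancel (Nat.one_le_pow j p hp.out.pos), pow_succ, hj, one_mul]
  have hcd : (π ^ L) ^ p ^ (2 * d) = π ^ L := by
    refine hfix _ _ ?_
    obtain ⟨e, he⟩ := hdvd
    rw [he, pow_mul, hc, one_pow]
  have hct : ((π ^ L) ^ (p ^ d + 1)) ^ p ^ t = (π ^ L) ^ (p ^ d + 1) :=
    hfix _ _ (by rw [← pow_mul, mul_comm, hc])
  rw [wt1_eq_card_range h hF ht h2 hα, hL, mul_comm _ L, card_filter_range_mul_of_periodic]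
  · exact dvd_mul_right _ _
  · intro i
    simp only [pow_add π i L]
    rw [mul_comm, h.hermForm_mul hcd, trSum_mul_of_fixed hct, ne_eq, ne_eq,
      mul_eq_zero_iff_left (pow_ne_zero _ (pow_ne_zero _ hπ0))]

include h hF in
lemma exists_formSum_eq {ψ : AddChar F ℂ} (hψ : IsTraceChar p n ψ) (h2 : (2 : F) ≠ 0)
    (hodd : Odd p) {π : F} (hπ : ∀ x : F, x ≠ 0 → ∃ i : ℕ, π ^ i = x) {α β : F}
    (hα : α ^ p ^ m = α) (hαβ : ¬(α = 0 ∧ β = 0)) :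
    ∃ r ≤ 2, formSum p m k ψ α β = -(-1) ^ r * (p : ℂ) ^ (m + d * r) := by
  obtain ⟨r, hr⟩ := exists_card_radical_eq h hF α β
  have hsq := formSum_sq h hF hψ h2 hodd hα β
  have hle := card_radical_le h hF hαβ
  rw [hr] at hsq hle
  refine ⟨r, ?_, ?_⟩
  · rw [← pow_add, Nat.pow_le_pow_iff_right hp.out.one_lt,
      show 2 * d + 2 * d = 2 * d * 2 by ring] at hle
    exact Nat.le_of_mul_le_mul_left hle (Nat.mul_pos two_pos h.d_pos)
  · obtain ⟨ε, hε, hS⟩ : ∃ ε : ℤ, (ε = (-1) ^ r ∨ ε = -(-1) ^ r) ∧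
        formSum p m k ψ α β = ε * (p : ℂ) ^ (m + d * r) := by
      have hsq' : formSum p m k ψ α β ^ 2 = ((-1) ^ r * (p : ℂ) ^ (m + d * r)) ^ 2 := by
        rw [hsq, mul_pow, ← pow_mul, mul_comm r 2, pow_mul (-1 : ℂ), neg_one_sq, one_pow, one_mul,
          h.n_eq]
        push_cast
        ring
      rcases sq_eq_sq_iff_eq_or_eq_neg.1 hsq' with h1 | h1
      · exact ⟨(-1) ^ r, Or.inl rfl, by rw [h1]; push_cast; ring⟩
      · exact ⟨-(-1) ^ r, Or.inr rfl, by rw [h1]; push_cast; ring⟩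
    rcases hε with hε | hε
    · exfalso
      have hw := pow_mul_wt1 h hF h.d_pos dvd_rfl hψ h2 hπ hα β
      obtain ⟨w, hwd⟩ := dvd_wt1 h hF dvd_rfl h2 hπ hα β
      rw [hwd, hS] at hw
      have hQ : 1 < p ^ d := Nat.one_lt_pow h.d_pos.ne' hp.out.one_lt
      have hw' : (p : ℤ) ^ d * (((p : ℤ) ^ d - 1) * ((p : ℤ) ^ d + 1) * w) =
          ((p : ℤ) ^ d - 1) * ((p : ℤ) ^ n - ε * (p : ℤ) ^ (m + d * r)) := by
        rw [Nat.cast_mul, Nat.cast_mul, Nat.cast_sub hQ.le] at hw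
        push_cast at hw
        exact_mod_cast hw
      have hQ0 : (p : ℤ) ^ d - 1 ≠ 0 := by
        have : (1 : ℤ) < (p : ℤ) ^ d := by exact_mod_cast hQ
        omega
      have hd1 : (p : ℤ) ^ d + 1 ∣ (p : ℤ) ^ n - ε * (p : ℤ) ^ (m + d * r) :=
        ⟨(p : ℤ) ^ d * w, mul_left_cancel₀ hQ0 (by linear_combination -hw')⟩
      obtain ⟨s, hs, hms⟩ := h.m_eq
      have hmod : (p : ℤ) ^ d ≡ -1 [ZMOD (p : ℤ) ^ d + 1] :=
        (Int.modEq_iff_dvd.2 ⟨-1, by ring⟩)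
      have hq : (p : ℤ) ^ n ≡ 1 [ZMOD (p : ℤ) ^ d + 1] := by
        have := hmod.pow (s * 2)
        rwa [← pow_mul, ← mul_assoc, ← hms, mul_comm m, ← h.n_eq, mul_comm s, pow_mul (-1 : ℤ),
          neg_one_sq, one_pow] at this
      have hmr : (p : ℤ) ^ (m + d * r) ≡ -(-1) ^ r [ZMOD (p : ℤ) ^ d + 1] := by
        have := hmod.pow (s + r)
        rwa [← pow_mul, mul_add, ← hms, pow_add (-1 : ℤ), hs.neg_one_pow, neg_one_mul] at this
      have hd2 := (Int.modEq_zero_iff_dvd.2 hd1).symm.trans (hq.sub (hmr.mul_left ε))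
      rw [hε, mul_neg, ← mul_pow, neg_one_mul, neg_neg, one_pow] at hd2
      have hd3 := Int.le_of_dvd (by norm_num) (Int.modEq_zero_iff_dvd.1 hd2.symm)
      have : (1 : ℤ) < (p : ℤ) ^ d := by exact_mod_cast hQ
      omega
    · rw [hS, hε]
      push_cast
      ring

end Weights

lemma oddMultiples_of_gcd {d m k n : ℕ} (hm : 0 < m) (hn : n = 2 * m) (hk : k ≤ n)
    (hd : d = Nat.gcd m k) (hcase : Nat.gcd (m + k) (2 * k) = 2 * d) : OddMultiples d m k n := by
  have hd0 : 0 < d := hd ▸ Nat.gcd_pos_of_pos_left k hm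
  obtain ⟨s, hs⟩ : d ∣ m := hd ▸ Nat.gcd_dvd_left m k
  obtain ⟨r, hr⟩ : d ∣ k := hd ▸ Nat.gcd_dvd_right m k
  have hsr : Nat.gcd s r = 1 := by
    have h1 := hd
    rw [hs, hr, Nat.gcd_mul_left] at h1
    exact Nat.eq_of_mul_eq_mul_left hd0 (by rw [mul_one, ← h1])
  have h2 : 2 ∣ s + r := by
    have h1 : 2 * d ∣ d * (s + r) := by
      rw [mul_add, ← hs, ← hr, ← hcase]
      exact Nat.gcd_dvd_left _ _
    rw [mul_comm 2 d] at h1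
    exact Nat.dvd_of_mul_dvd_mul_left hd0 h1
  have hodd : Odd s ∧ Odd r := by
    rcases Nat.even_or_odd s with hse | hso
    · have hre : Even r := (Nat.even_add.1 (even_iff_two_dvd.2 h2)).1 hse
      have := Nat.dvd_gcd hse.two_dvd hre.two_dvd
      rw [hsr] at this
      omega
    · refine ⟨hso, Nat.not_even_iff_odd.1 fun hre => ?_⟩
      exact Nat.not_even_iff_odd.2 hso ((Nat.even_add.1 (even_iff_two_dvd.2 h2)).2 hre)
  exact ⟨hd0, ⟨s, hodd.1, hs⟩, ⟨r, hodd.2, hr⟩, hd.symm, hn, hk⟩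

lemma OddMultiples.three_mul_le {d m k n : ℕ} (h : OddMultiples d m k n) (hk : k < n)
    (hkm : k ≠ m) : 3 * d ≤ m := by
  obtain ⟨s, hs, hms⟩ := h.m_eq
  obtain ⟨r, hr, hkr⟩ := h.k_eq
  have hs1 : s ≠ 1 := by
    rintro rfl
    rw [h.n_eq, hkr, hms, mul_one, mul_comm 2 d] at hk
    have := lt_of_mul_lt_mul_left hk d.zero_le
    obtain ⟨i, rfl⟩ := hr
    obtain rfl : i = 0 := by omega
    exact hkm (by rw [hkr, hms, mul_zero, zero_add])
  have hs3 : 3 ≤ s := by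
    obtain ⟨i, rfl⟩ := hs
    omega
  rw [hms, mul_comm]
  exact Nat.mul_le_mul_left d hs3

lemma sum_comp_eq_four_values {ι : Type*} (S : Finset ι) (g : ι → ℤ) {a b c e : ℤ}
    (hab : a ≠ b) (hac : a ≠ c) (hae : a ≠ e) (hbc : b ≠ c) (hbe : b ≠ e) (hce : c ≠ e)
    (hg : ∀ x ∈ S, g x = a ∨ g x = b ∨ g x = c ∨ g x = e) (φ : ℤ → ℤ) :
    ∑ x ∈ S, φ (g x) = (S.filter (g · = a)).card * φ a + (S.filter (g · = b)).card * φ b +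
      (S.filter (g · = c)).card * φ c + (S.filter (g · = e)).card * φ e := by
  simp only [← nsmul_eq_mul, ← Finset.sum_const, Finset.sum_filter, ← Finset.sum_add_distrib]
  refine Finset.sum_congr rfl fun x hx => ?_
  rcases hg x hx with h | h | h | h <;> simp [h, hab, hac, hae, hbc, hbe, hce, hab.symm,
    hac.symm, hae.symm, hbc.symm, hbe.symm, hce.symm]

/-- The frequencies are determined by the power moments of orders zero to two. -/
lemma frequencies_of_moments {P Q X N₀ N₁ N₂ : ℤ} (hP : P = X * Q ^ 3) (hP0 : P ≠ 0)
    (hQ0 : Q ≠ 0) (h0 : N₀ + N₁ + N₂ + 1 = P ^ 3)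
    (h1 : N₀ * -P + N₁ * (P * Q) + N₂ * -(P * Q ^ 2) + P ^ 2 = P ^ 3)
    (h2 : N₀ * (-P) ^ 2 + N₁ * (P * Q) ^ 2 + N₂ * (-(P * Q ^ 2)) ^ 2 + (P ^ 2) ^ 2 =
      P ^ 3 * (1 + (P ^ 2 - 1) * (Q + 1))) :
    (Q + 1) ^ 2 * N₁ = Q * (P ^ 2 - 1) * (P + X * Q ^ 2 + X * Q + 1) ∧
    (Q + 1) * (Q ^ 2 - 1) * N₀ = Q ^ 3 * (P - 1) *
      (P ^ 2 - X ^ 2 * Q ^ 4 - X ^ 2 * Q ^ 3 + P - X * Q ^ 2 + 1) ∧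
    (Q + 1) * (Q ^ 2 - 1) * N₂ = (X * Q ^ 2 - 1) * (P ^ 2 - 1) := by
  have h1' : -N₀ + Q * N₁ - Q ^ 2 * N₂ = P ^ 2 - P :=
    mul_left_cancel₀ hP0 (by linear_combination h1)
  have h2' : N₀ + Q ^ 2 * N₁ + Q ^ 4 * N₂ = P * (1 + (P ^ 2 - 1) * (Q + 1)) - P ^ 2 :=
    mul_left_cancel₀ (pow_ne_zero 2 hP0) (by linear_combination h2)
  subst hP
  refine ⟨?_, ?_, ?_⟩
  · exact mul_left_cancel₀ hQ0 (by linear_combination h2' + (1 + Q ^ 2) * h1' + Q ^ 2 * h0)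
  · linear_combination -h2' + (Q - Q ^ 2) * h1' + Q ^ 3 * h0
  · exact mul_left_cancel₀ hQ0 (by linear_combination h2' - (Q - 1) * h1' - Q * h0)

lemma pow_mul_weight_add {p t a b : ℕ} (hp : 0 < p) (ha : t ≤ a) (hb : t ≤ b) :
    (p : ℤ) ^ t * ((p ^ t - 1) * (p ^ (a - t) + p ^ (b - t)) : ℕ) =
      ((p : ℤ) ^ t - 1) * ((p : ℤ) ^ a + (p : ℤ) ^ b) := by
  rw [Nat.cast_mul, Nat.cast_sub (Nat.one_le_pow _ _ hp), ← pow_mul_pow_sub (p : ℤ) ha,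
    ← pow_mul_pow_sub (p : ℤ) hb]
  push_cast
  ring

lemma pow_mul_weight_sub {p t a b : ℕ} (hp : 0 < p) (hb : t ≤ b) (hab : b ≤ a) :
    (p : ℤ) ^ t * ((p ^ t - 1) * (p ^ (a - t) - p ^ (b - t)) : ℕ) =
      ((p : ℤ) ^ t - 1) * ((p : ℤ) ^ a - (p : ℤ) ^ b) := by
  rw [Nat.cast_mul, Nat.cast_sub (Nat.one_le_pow _ _ hp),
    Nat.cast_sub (Nat.pow_le_pow_right hp (by omega)), ← pow_mul_pow_sub (p : ℤ) (hb.trans hab),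
    ← pow_mul_pow_sub (p : ℤ) hb]
  push_cast
  ring

section Distribution

variable {F : Type} [Field F] [Fintype F] {p d m k n t : ℕ} [hp : Fact p.Prime] [CharP F p]
  (h : OddMultiples d m k n) (hF : Fintype.card F = p ^ n) (ht0 : 0 < t) (ht : t ∣ d)

include h hF ht0 ht in
lemma wt1_eq_iff {ψ : AddChar F ℂ} (hψ : IsTraceChar p n ψ) (h2 : (2 : F) ≠ 0) {π : F}
    (hπ : ∀ x : F, x ≠ 0 → ∃ i : ℕ, π ^ i = x) {α : F} (hα : α ^ p ^ m = α) (β : F) {W : ℕ}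
    {T z : ℤ} (hz : formSum p m k ψ α β = z)
    (hW : (p : ℤ) ^ t * W = ((p : ℤ) ^ t - 1) * ((p : ℤ) ^ n - T)) :
    wt1 p m n k t π α β = W ↔ z = T := by
  have hw := pow_mul_wt1 h hF ht0 ht hψ h2 hπ hα β
  rw [hz] at hw
  have hw' : (p : ℤ) ^ t * wt1 p m n k t π α β = ((p : ℤ) ^ t - 1) * ((p : ℤ) ^ n - z) := by
    exact_mod_cast hw
  have ht1 : (1 : ℤ) < (p : ℤ) ^ t := by
    exact_mod_cast Nat.one_lt_pow ht0.ne' hp.out.one_lt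
  constructor
  · intro he
    rw [he, hW] at hw'
    linarith [mul_left_cancel₀ (by omega) hw']
  · intro he
    rw [he, ← hW] at hw'
    exact_mod_cast mul_left_cancel₀ (by omega) hw'

end Distribution

set_option maxHeartbeats 400000 in
theorem stmt13 (p m k n d d' : ℕ) (hp : Nat.Prime p) (hodd : p % 2 = 1)
    (hm : 0 < m) (hn : n = 2 * m) (hk : k ≤ n - 1) (hkm : k ≠ m)
    (hd : d = Nat.gcd m k) (hd' : d' = Nat.gcd (m + k) (2 * k))
    (F : Type) [Field F] [Fintype F] [Algebra (ZMod p) F] (hF : Fintype.card F = p ^ n) (t : ℕ) (ht0 : 0 < t) (ht : t ∣ d)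
    (π : F) (hπ : ∀ x : F, x ≠ 0 → ∃ i : ℕ, π ^ i = x)
    (hcase : d' = 2 * d) :
    (((p : ℤ) ^ d + 1) ^ 2 *
        (wt1count p m n k t F π ((p ^ t - 1) * (p ^ (n - t) - p ^ (m + d - t))) : ℤ)
        = (p : ℤ) ^ d * ((p : ℤ) ^ n - 1) *
          ((p : ℤ) ^ m + (p : ℤ) ^ (m - d) + (p : ℤ) ^ (m - 2 * d) + 1)) ∧
    (((p : ℤ) ^ d + 1) * ((p : ℤ) ^ (2 * d) - 1) *
        (wt1count p m n k t F π ((p ^ t - 1) * (p ^ (n - t) + p ^ (m - t))) : ℤ)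
        = (p : ℤ) ^ (3 * d) * ((p : ℤ) ^ m - 1) *
          ((p : ℤ) ^ n - (p : ℤ) ^ (n - 2 * d) - (p : ℤ) ^ (n - 3 * d)
            + (p : ℤ) ^ m - (p : ℤ) ^ (m - d) + 1)) ∧
    (((p : ℤ) ^ d + 1) * ((p : ℤ) ^ (2 * d) - 1) *
        (wt1count p m n k t F π ((p ^ t - 1) * (p ^ (n - t) + p ^ (m + 2 * d - t))) : ℤ)
        = ((p : ℤ) ^ (m - d) - 1) * ((p : ℤ) ^ n - 1)) ∧
    (wt1count p m n k t F π 0 = 1) ∧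
    (∀ α β : F, α ^ p ^ m = α →
      wt1 p m n k t π α β = (p ^ t - 1) * (p ^ (n - t) - p ^ (m + d - t)) ∨
      wt1 p m n k t π α β = (p ^ t - 1) * (p ^ (n - t) + p ^ (m - t)) ∨
      wt1 p m n k t π α β = (p ^ t - 1) * (p ^ (n - t) + p ^ (m + 2 * d - t)) ∨
      wt1 p m n k t π α β = 0) := by
  have : Fact p.Prime := ⟨hp⟩
  have : CharP F p := charP_of_injective_algebraMap (algebraMap (ZMod p) F).injective p
  have hpodd : Odd p := Nat.odd_iff.2 hodd
  have h2 : (2 : F) ≠ 0 := by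
    have h := (CharP.cast_eq_zero_iff F p 2).not.2 fun hp2 => by
      have := (Nat.prime_dvd_prime_iff_eq hp Nat.prime_two).1 hp2
      omega
    exact_mod_cast h
  have h : OddMultiples d m k n :=
    oddMultiples_of_gcd hm hn (by omega) hd (hd' ▸ hcase)
  have hdm := h.three_mul_le (by omega) hkm
  have hd0 := h.d_pos
  have htd := Nat.le_of_dvd hd0 ht
  obtain ⟨ψ, hψ⟩ := exists_isTraceChar p n F hF
  set P : ℤ := (p : ℤ) ^ m with hP
  set Q : ℤ := (p : ℤ) ^ d with hQ
  set X : ℤ := (p : ℤ) ^ (m - 3 * d) with hX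
  have hp1 : (1 : ℤ) < p := by exact_mod_cast hp.one_lt
  have hQ1 : 1 < Q := one_lt_pow₀ hp1 hd0.ne'
  have hX1 : 1 ≤ X := one_le_pow₀ hp1.le
  have hPX : P = X * Q ^ 3 := by
    rw [hP, hX, hQ, ← pow_mul, ← pow_add]
    congr 1
    omega
  have hPQ : Q < P := by
    rw [hPX]
    nlinarith [mul_pos (by omega : 0 < Q) (by omega : 0 < Q), pow_pos (by omega : 0 < Q) 3]
  have hPn : (p : ℤ) ^ n = P ^ 2 := by rw [hP, hn, ← pow_mul, mul_comm]
  have hval : ∀ α β : F, ∃ z : ℤ, α ^ p ^ m = α → formSum p m k ψ α β = z ∧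
      ((z = -P ∨ z = P * Q ∨ z = -(P * Q ^ 2)) ∧ ¬(α = 0 ∧ β = 0) ∨
        z = P ^ 2 ∧ α = 0 ∧ β = 0) := by
    intro α β
    by_cases hαβ : α = 0 ∧ β = 0
    · refine ⟨P ^ 2, fun _ => ⟨?_, Or.inr ⟨rfl, hαβ⟩⟩⟩
      rw [hαβ.1, hαβ.2, formSum_zero_zero hF, ← hPn]
      push_cast
      rfl
    · by_cases hα : α ^ p ^ m = α
      · obtain ⟨r, hr, hs⟩ := exists_formSum_eq h hF hψ h2 hpodd hπ hα hαβ
        refine ⟨-(-1) ^ r * (P * Q ^ r), fun _ => ⟨?_, Or.inl ⟨?_, hαβ⟩⟩⟩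
        · rw [hs, hP, hQ]
          push_cast
          rw [pow_add, pow_mul]
        · interval_cases r <;> simp
      · exact ⟨0, fun hα' => absurd hα' hα⟩
  choose g hg using hval
  have hW₀ : (p : ℤ) ^ t * ((p ^ t - 1) * (p ^ (n - t) + p ^ (m - t)) : ℕ) =
      ((p : ℤ) ^ t - 1) * ((p : ℤ) ^ n - -P) := by
    rw [pow_mul_weight_add hp.pos (by omega) (by omega), sub_neg_eq_add]
  have hW₁ : (p : ℤ) ^ t * ((p ^ t - 1) * (p ^ (n - t) - p ^ (m + d - t)) : ℕ) =
      ((p : ℤ) ^ t - 1) * ((p : ℤ) ^ n - P * Q) := by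
    rw [pow_mul_weight_sub hp.pos (by omega) (by omega), hP, hQ, ← pow_add]
  have hW₂ : (p : ℤ) ^ t * ((p ^ t - 1) * (p ^ (n - t) + p ^ (m + 2 * d - t)) : ℕ) =
      ((p : ℤ) ^ t - 1) * ((p : ℤ) ^ n - -(P * Q ^ 2)) := by
    rw [pow_mul_weight_add hp.pos (by omega) (by omega), sub_neg_eq_add, hP, hQ, ← pow_mul,
      ← pow_add, mul_comm d 2]
  have hW₃ : (p : ℤ) ^ t * (0 : ℕ) = ((p : ℤ) ^ t - 1) * ((p : ℤ) ^ n - P ^ 2) := by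
    rw [hPn]
    simp
  set S : Finset (F × F) := frobFixed F p m ×ˢ Finset.univ with hS
  have hmemS : ∀ ab : F × F, ab ∈ S ↔ ab.1 ^ p ^ m = ab.1 := fun ab => by
    simp [hS, mem_frobFixed]
  have hcount : ∀ {W : ℕ} {T : ℤ}, (p : ℤ) ^ t * W = ((p : ℤ) ^ t - 1) * ((p : ℤ) ^ n - T) →
      wt1count p m n k t F π W = (S.filter fun ab => g ab.1 ab.2 = T).card := by
    intro W T hW
    refine Nat.subtype_card _ fun ab => ?_
    rw [Finset.mem_filter, hmemS]
    exact and_congr_right fun hα =>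
      (wt1_eq_iff h hF ht0 ht hψ h2 hπ hα _ (hg _ _ hα).1 hW).symm
  have hPP : P * Q < P ^ 2 := by nlinarith
  have hP0 : 0 < P := by omega
  have hPQ1 : P < P * Q := by nlinarith
  have hPQ2 : P * Q < P * Q ^ 2 := by nlinarith
  have hgS : ∀ ab ∈ S, g ab.1 ab.2 = -P ∨ g ab.1 ab.2 = P * Q ∨ g ab.1 ab.2 = -(P * Q ^ 2) ∨
      g ab.1 ab.2 = P ^ 2 := fun ab hab => by
    rcases (hg _ _ ((hmemS ab).1 hab)).2 with ⟨h1 | h1 | h1, -⟩ | ⟨h1, -⟩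
    · exact Or.inl h1
    · exact Or.inr (Or.inl h1)
    · exact Or.inr (Or.inr (Or.inl h1))
    · exact Or.inr (Or.inr (Or.inr h1))
  have hmom := sum_comp_eq_four_values S (fun ab => g ab.1 ab.2) (a := -P) (b := P * Q)
    (c := -(P * Q ^ 2)) (e := P ^ 2) (by omega) (by omega) (by omega) (by omega) (by omega)
    (by omega) hgS
  have hone : (S.filter fun ab => g ab.1 ab.2 = P ^ 2).card = 1 := by
    rw [Finset.card_eq_one]
    refine ⟨(0, 0), ?_⟩
    ext ⟨α, β⟩
    rw [Finset.mem_filter, hmemS, Finset.mem_singleton, Prod.mk.injEq]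
    constructor
    · rintro ⟨hα, hgP⟩
      change g α β = P ^ 2 at hgP
      rcases (hg α β hα).2 with ⟨h1 | h1 | h1, -⟩ | ⟨-, h1⟩
      · omega
      · omega
      · omega
      · exact h1
    · intro h1
      have hα : α ^ p ^ m = α := by simp [h1.1, hp.ne_zero]
      refine ⟨hα, ?_⟩
      rcases (hg α β hα).2 with ⟨-, h3⟩ | ⟨h3, -⟩
      · exact absurd h1 h3
      · exact h3
  have hsum : ∀ j : ℕ, ((∑ ab ∈ S, g ab.1 ab.2 ^ j : ℤ) : ℂ) =
      ∑ α ∈ frobFixed F p m, ∑ β : F, formSum p m k ψ α β ^ j := by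
    intro j
    rw [hS, Finset.sum_product]
    push_cast
    refine Finset.sum_congr rfl fun α hα => Finset.sum_congr rfl fun β _ => ?_
    rw [(hg α β (mem_frobFixed.1 hα)).1]
  have hmn : m ∣ n := ⟨2, by rw [hn, mul_comm]⟩
  have hm0 : (∑ ab ∈ S, (fun _ => (1 : ℤ)) (g ab.1 ab.2)) = P ^ 3 := by
    simp only [Finset.sum_const, nsmul_eq_mul, mul_one, hS, Finset.card_product,
      card_frobFixed hF hm hmn, Finset.card_univ, hF]
    push_cast
    rw [hPn, hP]
    ring
  have hm1 : (∑ ab ∈ S, (fun z => z) (g ab.1 ab.2)) = P ^ 3 := by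
    have := hsum 1
    simp only [pow_one] at this
    rw [sum_formSum h hF hψ h2] at this
    have h3 : ∑ ab ∈ S, g ab.1 ab.2 = (p : ℤ) ^ m * (p : ℤ) ^ n := by exact_mod_cast this
    simp only [h3, hPn]
    ring
  have hm2 : (∑ ab ∈ S, (fun z => z ^ 2) (g ab.1 ab.2)) =
      P ^ 3 * (1 + (P ^ 2 - 1) * (Q + 1)) := by
    have := hsum 2
    rw [sum_formSum_sq h hF hψ h2 hpodd] at this
    have h3 : ∑ ab ∈ S, g ab.1 ab.2 ^ 2 = (p : ℤ) ^ m * (p : ℤ) ^ n *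
        (1 + ((p : ℤ) ^ n - 1) * ((p : ℤ) ^ d + 1)) := by exact_mod_cast this
    simp only [h3, hPn]
    ring
  rw [hmom (fun _ => 1), hone] at hm0
  rw [hmom (fun z => z), hone] at hm1
  rw [hmom (fun z => z ^ 2), hone] at hm2
  obtain ⟨r₁, r₀, r₂⟩ := frequencies_of_moments hPX hP0.ne' (by omega)
    (by simpa using hm0) (by simpa using hm1) (by simpa using hm2)
  have e1 : (p : ℤ) ^ (m - d) = X * Q ^ 2 := by
    rw [hX, hQ, ← pow_mul, ← pow_add]; congr 1; omega
  have e2 : (p : ℤ) ^ (m - 2 * d) = X * Q := by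
    rw [hX, hQ, ← pow_add]; congr 1; omega
  have e3 : (p : ℤ) ^ (n - 2 * d) = X ^ 2 * Q ^ 4 := by
    rw [hX, hQ, ← pow_mul, ← pow_mul, ← pow_add]; congr 1; omega
  have e4 : (p : ℤ) ^ (n - 3 * d) = X ^ 2 * Q ^ 3 := by
    rw [hX, hQ, ← pow_mul, ← pow_mul, ← pow_add]; congr 1; omega
  have e5 : (p : ℤ) ^ (2 * d) = Q ^ 2 := by rw [hQ, ← pow_mul, mul_comm]
  have e6 : (p : ℤ) ^ (3 * d) = Q ^ 3 := by rw [hQ, ← pow_mul, mul_comm]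
  rw [hcount hW₀, hcount hW₁, hcount hW₂, hcount hW₃, e1, e2, e3, e4, e5, e6, hPn]
  refine ⟨r₁, r₀, r₂, hone, fun α β hα => ?_⟩
  obtain ⟨hz, -⟩ := hg α β hα
  rw [wt1_eq_iff h hF ht0 ht hψ h2 hπ hα β hz hW₀, wt1_eq_iff h hF ht0 ht hψ h2 hπ hα β hz hW₁,
    wt1_eq_iff h hF ht0 ht hψ h2 hπ hα β hz hW₂, wt1_eq_iff h hF ht0 ht hψ h2 hπ hα β hz hW₃]
  have := hgS (α, β) ((hmemS _).2 hα)
  tauto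
end
end
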